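/- High-degree vertices have many smaller siblings. Under assumptions (A1) and (A2), for every ν > 0, with ν-high probability, for every x ∈ V_ν^(h) that has a parent x̂ in G^p: #Sib^−(x) ≥ D_{x̂}^p / 2. -/

import Mathlib

open MeasureTheory Real

namespace GRG

variable {N : ℕ}

/-! ### Generic graph-theoretic definitions over an adjacency relation on `Fin N` -/

/-- The degree of a vertex with respect to an adjacency relation. -/
noncomputable def degA (A : Fin N → Fin N → Prop) (x : Fin N) : ℕ :=
  {y | A x y}.ncard

/-- The strict total order `≺`: `x ≺ y` iff `D_x < D_y`, or `D_x = D_y` and `x > y`. -/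
def precA (A : Fin N → Fin N → Prop) (x y : Fin N) : Prop :=
  degA A x < degA A y ∨ (degA A x = degA A y ∧ y < x)

/-- `γ 0, γ 1, …, γ l` is a path for the adjacency relation `A`. -/
def IsPathOn (A : Fin N → Fin N → Prop) (l : ℕ) (γ : ℕ → Fin N) : Prop :=
  ∀ i < l, A (γ i) (γ (i + 1))

/-- A path of length `l` is simple: all vertices distinct except possibly endpoints. -/
def IsSimplePath (l : ℕ) (γ : ℕ → Fin N) : Prop :=
  ∀ i j, i < j → j ≤ l → ¬(i = 0 ∧ j = l) → γ i ≠ γ j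

/-- Two paths are edge-disjoint. -/
def EdgeDisjoint (l l' : ℕ) (γ γ' : ℕ → Fin N) : Prop :=
  ∀ i < l, ∀ j < l',
    ¬((γ i = γ' j ∧ γ (i + 1) = γ' (j + 1)) ∨ (γ i = γ' (j + 1) ∧ γ (i + 1) = γ' j))

/-- `S_1^cyc(x)`: neighbours of `x` that start a simple cycle through `x`
of length at most `2r+1`. -/
def S1cycA (A : Fin N → Fin N → Prop) (r : ℕ) (x : Fin N) : Set (Fin N) :=
  {y | A x y ∧ ∃ l γ, 3 ≤ l ∧ l ≤ 2 * r + 1 ∧ γ 0 = x ∧ γ 1 = y ∧ γ l = x ∧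
    IsPathOn A l γ ∧ IsSimplePath l γ}

/-- `S_1^du(x)`: neighbours `y ∉ S_1^cyc(x)` of `x` that have a neighbour
`z ∉ S_1^cyc(y)` with `y ≺ x ≺ z`. -/
def S1duA (A : Fin N → Fin N → Prop) (r : ℕ) (x : Fin N) : Set (Fin N) :=
  {y | A x y ∧ y ∉ S1cycA A r x ∧ precA A y x ∧
    ∃ z, A y z ∧ z ∉ S1cycA A r y ∧ precA A x z}

/-- Adjacency in the graph `G^nc` (after removing the cycle-creating edges). -/
def AdjNCA (A : Fin N → Fin N → Prop) (r : ℕ) (x y : Fin N) : Prop :=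
  A x y ∧ y ∉ S1cycA A r x ∧ x ∉ S1cycA A r y

/-- Adjacency in the pruned graph `G^p` (after further removing the down-up edges). -/
def AdjPA (A : Fin N → Fin N → Prop) (r : ℕ) (x y : Fin N) : Prop :=
  AdjNCA A r x y ∧ y ∉ S1duA A r x ∧ x ∉ S1duA A r y

/-- Degree in the pruned graph. -/
noncomputable def degPA (A : Fin N → Fin N → Prop) (r : ℕ) (x : Fin N) : ℕ :=
  {y | AdjPA A r x y}.ncard

/-- `S_1^{p−}(x)`: pruned-graph neighbours of `x` that are smaller than `x` for `≺`. -/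
def S1pmA (A : Fin N → Fin N → Prop) (r : ℕ) (x : Fin N) : Set (Fin N) :=
  {y | AdjPA A r x y ∧ precA A y x}

/-- `D_x^{p−}`. -/
noncomputable def degPmA (A : Fin N → Fin N → Prop) (r : ℕ) (x : Fin N) : ℕ :=
  (S1pmA A r x).ncard

/-- `Sib^−(x)`: the smaller siblings of `x` (children of the parent of `x`
that are smaller than `x`). -/
def SibmA (A : Fin N → Fin N → Prop) (r : ℕ) (x : Fin N) : Set (Fin N) :=
  {y | ∃ p, AdjPA A r x p ∧ precA A x p ∧ AdjPA A r p y ∧ precA A y p ∧ precA A y x}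

/-- The normalization constant `Z_x` (note `2/0 = 0` in Lean, so this agrees with the
convention `Z_x = 2` when `Sib^−(x) = ∅`). -/
noncomputable def ZxA (A : Fin N → Fin N → Prop) (r : ℕ) (x : Fin N) : ℝ :=
  2 + 2 / (SibmA A r x).ncard

/-- The indicator vector of a set of vertices. -/
noncomputable def indVec (S : Set (Fin N)) : Fin N → ℝ :=
  S.indicator 1

/-- The approximate eigenvector `u_σ(x)`. -/
noncomputable def uVecA (A : Fin N → Fin N → Prop) (r : ℕ) (σ : ℝ) (x : Fin N) :
    Fin N → ℝ := fun y =>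
  (Real.sqrt (ZxA A r x))⁻¹ *
    (indVec {x} y + σ * (Real.sqrt (degPmA A r x))⁻¹ * indVec (S1pmA A r x) y -
      indVec (SibmA A r x) y / (SibmA A r x).ncard)

/-- The star vector `v_σ(x)`. -/
noncomputable def vVecA (A : Fin N → Fin N → Prop) (r : ℕ) (σ : ℝ) (x : Fin N) :
    Fin N → ℝ := fun y =>
  (Real.sqrt 2)⁻¹ *
    (indVec {x} y + σ * (Real.sqrt (degPmA A r x))⁻¹ * indVec (S1pmA A r x) y)

/-- Euclidean scalar product on `ℝ^N`. -/
noncomputable def dotR (f g : Fin N → ℝ) : ℝ := ∑ y, f y * g y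

/-- The Euclidean (`ℓ² → ℓ²`) operator norm of an `N × N` real matrix. -/
noncomputable def opNorm (M : Matrix (Fin N) (Fin N) ℝ) : ℝ :=
  ‖Matrix.toEuclideanCLM (𝕜 := ℝ) M‖

open Classical in
/-- The adjacency matrix of the pruned graph. -/
noncomputable def adjMatrixPA (A : Fin N → Fin N → Prop) (r : ℕ) :
    Matrix (Fin N) (Fin N) ℝ := fun x y => if AdjPA A r x y then 1 else 0

/-- The threshold `ξ_ν`. -/
noncomputable def xi (ν δ : ℝ) (N : ℕ) : ℝ :=
  3 * (ν + 1) * (2 - 3 * δ) / ((1 - δ) * (1 - 2 * δ)) *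
    (Real.log N / Real.log (Real.log N))

/-- The set `V_ν^{(h)}` of high-degree vertices. -/
def VhA (A : Fin N → Fin N → Prop) (ν δ : ℝ) : Set (Fin N) :=
  {x | xi ν δ N ≤ (degA A x : ℝ)}

/-- The projection `Π^p` onto the span of the vectors `u_σ(x)`, `x ∈ V_ν^{(h)}`. -/
noncomputable def PiPA (A : Fin N → Fin N → Prop) (r : ℕ) (ν δ : ℝ) :
    Matrix (Fin N) (Fin N) ℝ :=
  ∑ x : Fin N, Set.indicator (VhA A ν δ) (fun _ => (1 : ℝ)) x •
    (Matrix.vecMulVec (uVecA A r 1 x) (uVecA A r 1 x) +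
      Matrix.vecMulVec (uVecA A r (-1) x) (uVecA A r (-1) x))

/-- The block-diagonal approximation `Â`. -/
noncomputable def AhatA (A : Fin N → Fin N → Prop) (r : ℕ) (ν δ : ℝ) :
    Matrix (Fin N) (Fin N) ℝ :=
  (∑ x : Fin N, Set.indicator (VhA A ν δ) (fun _ => (1 : ℝ)) x •
    (Real.sqrt (degPmA A r x) •
      (Matrix.vecMulVec (uVecA A r 1 x) (uVecA A r 1 x) -
        Matrix.vecMulVec (uVecA A r (-1) x) (uVecA A r (-1) x)))) +
  (1 - PiPA A r ν δ) * adjMatrixPA A r * (1 - PiPA A r ν δ)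

/-! ### The generalized random graph (GRG) model -/

/-- Index set of potential edges. -/
abbrev EdgeIdx (N : ℕ) := {p : Fin N × Fin N // p.1 < p.2}

/-- The edge probabilities `p_{xy} = w_x w_y / (Σ_z w_z + w_x w_y)`. -/
noncomputable def pGRG (w : Fin N → ℝ) (x y : Fin N) : ℝ :=
  w x * w y / ((∑ z, w z) + w x * w y)

/-- Bernoulli measure with parameter `p` on `Bool`. -/
noncomputable def bern (p : ℝ) : Measure Bool :=
  ENNReal.ofReal p • Measure.dirac true + ENNReal.ofReal (1 - p) • Measure.dirac false

instance (p : ℝ) : IsFiniteMeasure (bern p) := by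
  constructor
  simp only [bern, Measure.coe_add, Measure.coe_smul, Pi.add_apply, Pi.smul_apply,
    smul_eq_mul, measure_univ, mul_one]
  exact ENNReal.add_lt_top.mpr ⟨ENNReal.ofReal_lt_top, ENNReal.ofReal_lt_top⟩

/-- The law of the GRG: independent Bernoulli edge indicators. -/
noncomputable def grgMeasure (w : Fin N → ℝ) : Measure (EdgeIdx N → Bool) :=
  Measure.pi fun e => bern (pGRG w e.val.1 e.val.2)

/-- The (random) adjacency matrix. -/
noncomputable def adjMatrix (ω : EdgeIdx N → Bool) : Matrix (Fin N) (Fin N) ℝ :=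
  fun x y =>
    if h : x < y then (if ω ⟨(x, y), h⟩ then 1 else 0)
    else if h' : y < x then (if ω ⟨(y, x), h'⟩ then 1 else 0)
    else 0

/-- The (random) adjacency relation. -/
def Adj (ω : EdgeIdx N → Bool) (x y : Fin N) : Prop := adjMatrix ω x y = 1

/-- The (random) degree `D_x`. -/
noncomputable def deg (ω : EdgeIdx N → Bool) (x : Fin N) : ℕ := degA (Adj ω) x

/-- The first empirical moment `m_1`. -/
noncomputable def m1 (w : Fin N → ℝ) : ℝ := (∑ x, w x) / N

/-- The second empirical moment `m_2`. -/
noncomputable def m2 (w : Fin N → ℝ) : ℝ := (∑ x, w x ^ 2) / N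

/-- The expected degree `d_x = E[D_x]`. -/
noncomputable def dExp (w : Fin N → ℝ) (x : Fin N) : ℝ :=
  ∫ ω, (deg ω x : ℝ) ∂(grgMeasure w)

/-- The set `W_{λ,η}` of resonant vertices. -/
def resonant (ω : EdgeIdx N → Bool) (lam η : ℝ) : Set (Fin N) :=
  {x | |Real.sqrt (deg ω x) - lam| ≤ η}

/-- The set `V*_{ν,η}` of isolated vertices. -/
noncomputable def Vstar (w : Fin N → ℝ) (ν η : ℝ) : Set (Fin N) :=
  {x | (4 * ν / 9) * Real.log N ≤ dExp w x ∧
    ∀ y, y ≠ x →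
      max (4 * Real.sqrt (ν * Real.log N * dExp w x) +
            4 * Real.sqrt (ν * Real.log N * dExp w y))
          (16 * η ^ 2) ≤ |dExp w x - dExp w y|}

end GRG


open MeasureTheory Real
namespace GRGP
open GRG ProbabilityTheory

lemma bern_prob {p : ℝ} (h0 : 0 ≤ p) (h1 : p ≤ 1) : IsProbabilityMeasure (bern p) := by
  constructor
  simp only [bern, Measure.coe_add, Measure.coe_smul, Pi.add_apply, Pi.smul_apply,
    smul_eq_mul, measure_univ, mul_one]
  rw [← ENNReal.ofReal_add h0 (by linarith)]
  simp

lemma bern_integral {p : ℝ} (h0 : 0 ≤ p) (h1 : p ≤ 1) (g : Bool → ℝ) :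
    ∫ b, g b ∂(bern p) = p * g true + (1 - p) * g false := by
  unfold bern
  have i1 : IsFiniteMeasure (ENNReal.ofReal p • Measure.dirac true) :=
    Measure.smul_finite _ ENNReal.ofReal_ne_top
  have i2 : IsFiniteMeasure (ENNReal.ofReal (1 - p) • Measure.dirac false) :=
    Measure.smul_finite _ ENNReal.ofReal_ne_top
  rw [integral_add_measure Integrable.of_finite Integrable.of_finite,
    integral_smul_measure, integral_smul_measure, integral_dirac, integral_dirac,
    ENNReal.toReal_ofReal h0, ENNReal.toReal_ofReal (by linarith)]
  simp

section
variable {N : ℕ} {w : Fin N → ℝ}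

/-- edge probability -/
noncomputable def pe (w : Fin N → ℝ) (e : EdgeIdx N) : ℝ := pGRG w e.val.1 e.val.2

lemma W_pos (hw : ∀ x, 0 < w x) (x : Fin N) : 0 < ∑ z, w z :=
  Finset.sum_pos (fun z _ => hw z) ⟨x, Finset.mem_univ x⟩

lemma p_nonneg (hw : ∀ x, 0 < w x) (x y : Fin N) : 0 ≤ pGRG w x y := by
  have := W_pos hw x
  have := hw x
  have := hw y
  unfold pGRG
  positivity

lemma p_le (hw : ∀ x, 0 < w x) (x y : Fin N) : pGRG w x y ≤ w x * w y / ∑ z, w z := by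
  have := W_pos hw x
  have hx := hw x
  have hy := hw y
  unfold pGRG
  apply div_le_div_of_nonneg_left (by positivity) this
  nlinarith [mul_pos hx hy]

lemma p_le_one (hw : ∀ x, 0 < w x) (x y : Fin N) : pGRG w x y ≤ 1 := by
  have := W_pos hw x
  have hx := hw x
  have hy := hw y
  unfold pGRG
  rw [div_le_one (by positivity)]
  linarith

lemma p_ge (hw : ∀ x, 0 < w x) (x y : Fin N) (h : w x * w y ≤ ∑ z, w z) :
    w x * w y / (2 * ∑ z, w z) ≤ pGRG w x y := by
  have := W_pos hw x
  have hx := hw x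
  have hy := hw y
  unfold pGRG
  apply div_le_div_of_nonneg_left (by positivity) (by positivity)
  linarith

lemma p_symm (w : Fin N → ℝ) (x y : Fin N) : pGRG w x y = pGRG w y x := by
  unfold pGRG; rw [mul_comm (w x)]

lemma grg_prob (hw : ∀ x, 0 < w x) : IsProbabilityMeasure (grgMeasure w) := by
  have : ∀ e : EdgeIdx N, IsProbabilityMeasure (bern (pGRG w e.val.1 e.val.2)) :=
    fun e => bern_prob (p_nonneg hw _ _) (p_le_one hw _ _)
  unfold grgMeasure
  infer_instance

open Classical in
/-- factorization over a set of edges `I` and a functional not depending on `I`. -/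
lemma factor (hw : ∀ x, 0 < w x) (I : Finset (EdgeIdx N)) (F : (EdgeIdx N → Bool) → ℝ)
    (hF : ∀ ω ω' : EdgeIdx N → Bool, (∀ e, e ∉ I → ω e = ω' e) → F ω = F ω')
    (g : EdgeIdx N → Bool → ℝ) :
    ∫ ω, F ω * ∏ e ∈ I, g e (ω e) ∂(grgMeasure w) =
      (∫ ω, F ω ∂(grgMeasure w)) * ∏ e ∈ I, (pe w e * g e true + (1 - pe w e) * g e false) := by
  have hpr : ∀ e : EdgeIdx N, IsProbabilityMeasure (bern (pGRG w e.val.1 e.val.2)) :=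
    fun e => bern_prob (p_nonneg hw _ _) (p_le_one hw _ _)
  set μ : EdgeIdx N → Measure Bool := fun e => bern (pGRG w e.val.1 e.val.2) with hμ
  have hpr' : ∀ e, IsProbabilityMeasure (μ e) := hpr
  have mp := measurePreserving_piEquivPiSubtypeProd μ (fun e => e ∈ I)
  let F' : ({e // e ∉ I} → Bool) → ℝ := fun η => F (fun e => if h : e ∉ I then η ⟨e, h⟩ else false)
  have hFF' : ∀ ω : EdgeIdx N → Bool, F ω = F' (fun e => ω e.1) := by
    intro ω
    apply hF
    intro e he
    simp [he]
  have gen : ∀ G : ({e // e ∈ I} → Bool) → ℝ,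
      ∫ ω, F ω * G (fun e => ω e.1) ∂(grgMeasure w) =
      (∫ a, G a ∂(Measure.pi fun i : {e // e ∈ I} => μ i)) *
      ∫ b, F' b ∂(Measure.pi fun i : {e // e ∉ I} => μ i) := by
    intro G
    rw [← integral_prod_mul G F']
    refine Eq.trans ?_ (Eq.trans (mp.integral_comp (MeasurableEquiv.measurableEmbedding _)
      (fun z => G z.1 * F' z.2)) (by congr!))
    unfold grgMeasure
    congr 1
    ext ω
    rw [hFF' ω, mul_comm]
    rfl
  have h1 := gen (fun _ => 1)
  have h2 := gen (fun a => ∏ e : {e // e ∈ I}, g e (a e))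
  simp only [mul_one, integral_const, probReal_univ, smul_eq_mul, one_mul] at h1
  rw [← h1, integral_fintype_prod_eq_prod (fun (e : {e // e ∈ I}) b => g e b)] at h2
  have h3 : ∀ ω : EdgeIdx N → Bool, ∏ e ∈ I, g e (ω e) = ∏ e : {e // e ∈ I}, g e (ω e) :=
    fun ω => (Finset.prod_coe_sort I (fun e => g e (ω e))).symm
  simp only [h3]
  rw [h2, mul_comm]
  congr 1
  rw [← Finset.prod_coe_sort I]
  apply Finset.prod_congr rfl
  intro e _
  exact bern_integral (p_nonneg hw _ _) (p_le_one hw _ _) _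

lemma factor_one (hw : ∀ x, 0 < w x) (I : Finset (EdgeIdx N))
    (g : EdgeIdx N → Bool → ℝ) :
    ∫ ω, ∏ e ∈ I, g e (ω e) ∂(grgMeasure w) =
      ∏ e ∈ I, (pe w e * g e true + (1 - pe w e) * g e false) := by
  have := grg_prob hw
  have h := factor hw I (fun _ => 1) (fun _ _ _ => rfl) g
  simpa using h

/-- Markov: if `f ≥ 1` on `s`, `f ≥ 0`, then `P(s) ≤ E f`. -/
lemma markov (hw : ∀ x, 0 < w x) (s : Set (EdgeIdx N → Bool)) (f : (EdgeIdx N → Bool) → ℝ)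
    (h0 : ∀ ω, 0 ≤ f ω) (h1 : ∀ ω ∈ s, 1 ≤ f ω) :
    (grgMeasure w).real s ≤ ∫ ω, f ω ∂(grgMeasure w) := by
  have := grg_prob hw
  have h := mul_meas_ge_le_integral_of_nonneg (μ := grgMeasure w) (f := f)
    (Filter.Eventually.of_forall h0) Integrable.of_finite 1
  rw [one_mul] at h
  exact (measureReal_mono (fun ω hω => h1 ω hω)).trans h

/-- the edge between two distinct vertices -/
def ed (x y : Fin N) (h : x ≠ y) : EdgeIdx N :=
  if hlt : x < y then ⟨(x, y), hlt⟩ else ⟨(y, x), lt_of_le_of_ne (not_lt.mp hlt) h.symm⟩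

lemma ed_symm (x y : Fin N) (h : x ≠ y) : ed x y h = ed y x h.symm := by
  unfold ed
  rcases lt_or_gt_of_ne h with h1 | h1
  · simp [h1, not_lt.mpr h1.le]
  · simp [h1, not_lt.mpr h1.le]

lemma pe_ed (w : Fin N → ℝ) (x y : Fin N) (h : x ≠ y) : pe w (ed x y h) = pGRG w x y := by
  unfold ed pe
  split_ifs
  · rfl
  · exact p_symm _ _ _

lemma ed_lt (e : EdgeIdx N) : ed e.1.1 e.1.2 e.2.ne = e := by
  unfold ed; simp [e.2]

lemma ed_eq_iff (x y x' y' : Fin N) (h : x ≠ y) (h' : x' ≠ y') :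
    ed x y h = ed x' y' h' ↔ (x = x' ∧ y = y') ∨ (x = y' ∧ y = x') := by
  unfold ed
  split_ifs with h1 h2 h2 <;> simp only [Subtype.mk.injEq, Prod.mk.injEq] <;>
    constructor <;> intro h3 <;> omega

lemma adj_iff (ω : EdgeIdx N → Bool) (x y : Fin N) :
    Adj ω x y ↔ ∃ h : x ≠ y, ω (ed x y h) = true := by
  unfold Adj adjMatrix ed
  rcases lt_trichotomy x y with h | h | h
  · simp [h, h.ne]
  · simp [h]
  · simp [h, not_lt.mpr h.le, h.ne']

lemma adj_symm {ω : EdgeIdx N → Bool} {x y : Fin N} (h : Adj ω x y) : Adj ω y x := by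
  rw [adj_iff] at *
  obtain ⟨h, h'⟩ := h
  exact ⟨h.symm, by rwa [← ed_symm]⟩

open Classical in
/-- edges at `p` -/
noncomputable def star (p : Fin N) : Finset (EdgeIdx N) :=
  Finset.univ.image (fun y : {y : Fin N // p ≠ y} => ed p y.1 y.2)

lemma ed_inj (p : Fin N) : Function.Injective (fun y : {y : Fin N // p ≠ y} => ed p y.1 y.2) := by
  intro a b hab
  simp only [ed_eq_iff] at hab
  apply Subtype.ext
  rcases hab with h | h
  · exact h.2
  · exact (b.2 h.1).elim

open Classical in
/-- star product formula: functional `F` not depending on the edges at `p`. -/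
lemma star_factor (hw : ∀ x, 0 < w x) (p : Fin N) (F : (EdgeIdx N → Bool) → ℝ)
    (hF : ∀ ω ω' : EdgeIdx N → Bool, (∀ e, e ∉ star p → ω e = ω' e) → F ω = F ω')
    (hF0 : ∀ ω, 0 ≤ F ω)
    (c : Fin N → ℝ) :
    ∫ ω, F ω * exp (∑ y, if Adj ω p y then c y else 0) ∂(grgMeasure w) ≤
      (∫ ω, F ω ∂(grgMeasure w)) *
        exp (∑ y ∈ Finset.univ.filter (fun y => p ≠ y), pGRG w p y * (exp (c y) - 1)) := by
  let oth : EdgeIdx N → Fin N := fun e => if e.1.1 = p then e.1.2 else e.1.1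
  have hoth : ∀ y : {y : Fin N // p ≠ y}, oth (ed p y.1 y.2) = y := by
    intro y
    unfold ed
    have := y.2
    split_ifs with h
    · simp [oth]
    · simp [oth, Ne.symm this]
  have h := factor hw (star p) F hF (fun e b => if b then exp (c (oth e)) else 1)
  have e1 : ∀ ω : EdgeIdx N → Bool, exp (∑ y, if Adj ω p y then c y else 0) =
      ∏ e ∈ star p, (if ω e then exp (c (oth e)) else 1) := by
    intro ω
    unfold star
    rw [Finset.prod_image (fun a _ b _ h => ed_inj p h), exp_sum]
    simp only [hoth]
    have h0 : ∏ y : Fin N, exp (if Adj ω p y then c y else 0) =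
        ∏ y ∈ Finset.univ.filter (fun y => p ≠ y), exp (if Adj ω p y then c y else 0) := by
      symm
      apply Finset.prod_subset (Finset.subset_univ _)
      intro y _ hy
      simp only [Finset.mem_filter, Finset.mem_univ, true_and, not_not] at hy
      have : ¬ Adj ω p y := by
        rw [adj_iff]; rintro ⟨h4, h3⟩; exact h4 hy
      simp [this]
    rw [h0, Finset.prod_subtype (Finset.univ.filter (fun y => p ≠ y)) (p := fun y => p ≠ y)
      (by simp)]
    apply Finset.prod_congr rfl
    rintro ⟨y, hy⟩ _
    by_cases h2 : ω (ed p y hy) = true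
    · have : Adj ω p y := (adj_iff _ _ _).2 ⟨hy, h2⟩
      simp [this, h2]
    · have : ¬ Adj ω p y := by
        rw [adj_iff]; rintro ⟨_, h3⟩; exact h2 h3
      simp [this, h2]
  simp only [e1]
  rw [h]
  apply mul_le_mul_of_nonneg_left _ (integral_nonneg hF0)
  unfold star
  rw [Finset.prod_image (fun a _ b _ h => ed_inj p h), exp_sum,
    Finset.prod_subtype (Finset.univ.filter (fun y => p ≠ y)) (p := fun y => p ≠ y) (by simp)]
  apply Finset.prod_le_prod
  · intro y _
    have h1 := p_nonneg hw p y
    have h2 := p_le_one hw p y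
    simp only [hoth, pe_ed, if_true]
    have : 0 ≤ 1 - pGRG w p y := by linarith
    simp only [Bool.false_eq_true, if_false]
    positivity
  · intro y _
    simp only [hoth, pe_ed, if_true]
    simp only [Bool.false_eq_true, if_false]
    refine le_trans (le_of_eq ?_) (add_one_le_exp _)
    ring
end
end GRGP

open MeasureTheory Real
namespace GRGP
open GRG ProbabilityTheory

section
variable {N : ℕ} {w : Fin N → ℝ}

open Classical in
lemma deg_eq_sum (ω : EdgeIdx N → Bool) (z : Fin N) (l : ℝ) :
    l * (degA (Adj ω) z : ℝ) = ∑ y, if Adj ω z y then l else 0 := by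
  unfold degA
  rw [Set.ncard_eq_toFinset_card']
  rw [← Finset.sum_filter, Finset.sum_const, nsmul_eq_mul, mul_comm]
  congr 2
  apply congrArg
  ext y; simp

/-- light vertices have small degree -/
lemma lemA (hw : ∀ x, 0 < w x) (z : Fin N) (l ξ : ℝ) (hl : 0 ≤ l) :
    (grgMeasure w).real {ω | ξ ≤ (degA (Adj ω) z : ℝ)} ≤ exp (w z * exp l - l * ξ) := by
  classical
  have hpr := grg_prob hw
  have hW := W_pos hw z
  have hz := hw z
  refine (markov hw _ (fun ω => exp (-(l * ξ)) * exp (∑ y, if Adj ω z y then l else 0))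
    (fun ω => by positivity) ?_).trans ?_
  · intro ω hω
    rw [← deg_eq_sum, ← exp_add]
    apply one_le_exp
    have : ξ ≤ (degA (Adj ω) z : ℝ) := hω
    nlinarith
  · refine (star_factor hw z (fun _ => exp (-(l * ξ))) (fun _ _ _ => rfl)
      (fun _ => by positivity) (fun _ => l)).trans ?_
    simp only [integral_const, probReal_univ, smul_eq_mul, one_mul]
    rw [← exp_add]
    apply exp_le_exp.mpr
    have h1 : 0 ≤ exp l - 1 := by linarith [one_le_exp hl]
    have : ∑ y ∈ Finset.univ.filter (fun y => z ≠ y), pGRG w z y * (exp l - 1) ≤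
        w z * (exp l - 1) := by
      calc _ ≤ ∑ y ∈ Finset.univ.filter (fun y => z ≠ y),
            w z * w y / (∑ z, w z) * (exp l - 1) :=
            Finset.sum_le_sum fun y _ => mul_le_mul_of_nonneg_right (p_le hw z y) h1
        _ ≤ ∑ y, w z * w y / (∑ z, w z) * (exp l - 1) := by
            apply Finset.sum_le_sum_of_subset_of_nonneg (Finset.subset_univ _)
            intro y _ _
            have := hw y
            positivity
        _ = w z * (exp l - 1) := by
            rw [← Finset.sum_mul, ← Finset.sum_div, ← Finset.mul_sum]
            field_simp
    nlinarith

lemma sum_pairs (f : Fin N → Fin N → ℝ) (hf : ∀ y, f y y = 0) :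
    ∑ y, ∑ z, f y z = ∑ e : EdgeIdx N, (f e.1.1 e.1.2 + f e.1.2 e.1.1) := by
  classical
  rw [← Finset.sum_product']
  rw [Finset.sum_add_distrib]
  have h1 : ∑ e : EdgeIdx N, f e.1.1 e.1.2 =
      ∑ q ∈ (Finset.univ : Finset (Fin N × Fin N)).filter (fun q => q.1 < q.2), f q.1 q.2 :=
    (Finset.sum_subtype (p := fun q : Fin N × Fin N => q.1 < q.2)
      (Finset.univ.filter (fun q : Fin N × Fin N => q.1 < q.2)) (by simp)
      (fun q => f q.1 q.2)).symm
  have h2 : ∑ e : EdgeIdx N, f e.1.2 e.1.1 =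
      ∑ q ∈ (Finset.univ : Finset (Fin N × Fin N)).filter (fun q => q.1 < q.2), f q.2 q.1 :=
    (Finset.sum_subtype (p := fun q : Fin N × Fin N => q.1 < q.2)
      (Finset.univ.filter (fun q : Fin N × Fin N => q.1 < q.2)) (by simp)
      (fun q => f q.2 q.1)).symm
  have h3 : ∑ q ∈ (Finset.univ : Finset (Fin N × Fin N)).filter (fun q => q.1 < q.2), f q.2 q.1 =
      ∑ q ∈ (Finset.univ : Finset (Fin N × Fin N)).filter (fun q => ¬ q.1 < q.2), f q.1 q.2 := by
    have : ∑ q ∈ (Finset.univ : Finset (Fin N × Fin N)).filter (fun q => q.2 < q.1), f q.1 q.2 =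
      ∑ q ∈ (Finset.univ : Finset (Fin N × Fin N)).filter (fun q => ¬ q.1 < q.2), f q.1 q.2 := by
      apply Finset.sum_subset
      · intro q; simp only [Finset.mem_filter, Finset.mem_univ, true_and, not_lt]
        exact le_of_lt
      · intro q hq hq'
        simp only [Finset.mem_filter, Finset.mem_univ, true_and, not_lt] at hq hq'
        have : q.1 = q.2 := le_antisymm hq' hq
        rw [this]; exact hf _
    rw [← this]
    apply Finset.sum_bij' (fun q _ => (q.2, q.1)) (fun q _ => (q.2, q.1)) <;> simp
  rw [h1, h2, h3, Finset.sum_filter_add_sum_filter_not]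
  simp

open Classical in
/-- The weight adjacent to `H` is small. -/
lemma lemB (hw : ∀ x, 0 < w x) (H : Finset (Fin N)) (κ l q b : ℝ) (hl : 0 ≤ l)
    (hb : ∀ x, w x ≤ b) (hlb : l * (2 * b) ≤ 1) (hκ : ∑ x, w x ^ 2 ≤ κ * ∑ x, w x) :
    (grgMeasure w).real
      {ω | q ≤ ∑ y ∈ Finset.univ.filter (fun y => ∃ z ∈ H, Adj ω y z), w y} ≤
      exp (l * (2 * (κ * ∑ z ∈ H, w z) - q)) := by
  let f : Fin N → Fin N → ℝ := fun y z => if z ∈ H then w y else 0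
  let c : EdgeIdx N → ℝ := fun e => f e.1.1 e.1.2 + f e.1.2 e.1.1
  have hf0 : ∀ y z, 0 ≤ f y z := by
    intro y z; simp only [f]; split_ifs; exacts [(hw y).le, le_rfl]
  have hfb : ∀ y z, f y z ≤ w y := by
    intro y z; simp only [f]; split_ifs; exacts [le_rfl, (hw y).le]
  have hc0 : ∀ e, 0 ≤ c e := fun e => add_nonneg (hf0 _ _) (hf0 _ _)
  have hc1 : ∀ e, l * c e ≤ 1 := by
    intro e
    have h1 := (hfb e.1.1 e.1.2).trans (hb _)
    have h2 := (hfb e.1.2 e.1.1).trans (hb _)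
    have : c e ≤ 2 * b := by simp only [c]; linarith
    nlinarith
  refine (markov hw _ (fun ω => exp (-(l * q)) * ∏ e, (if ω e then exp (l * c e) else 1))
    (fun ω => ?_) ?_).trans ?_
  · apply mul_nonneg (by positivity)
    apply Finset.prod_nonneg
    intro e _; split_ifs <;> positivity
  · intro ω hω
    have h1 : ∏ e, (if ω e then exp (l * c e) else 1) = exp (l * ∑ e, if ω e then c e else 0) := by
      rw [Finset.mul_sum, exp_sum]
      apply Finset.prod_congr rfl
      intro e _
      split_ifs <;> simp
    rw [h1, ← exp_add]
    apply one_le_exp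
    have h2 : q ≤ ∑ y ∈ Finset.univ.filter (fun y => ∃ z ∈ H, Adj ω y z), w y := hω
    have h3 : ∑ y ∈ Finset.univ.filter (fun y => ∃ z ∈ H, Adj ω y z), w y ≤
        ∑ y, ∑ z, (if Adj ω y z then f y z else 0) := by
      rw [Finset.sum_filter]
      apply Finset.sum_le_sum
      intro y _
      have hnn : ∀ z ∈ (Finset.univ : Finset (Fin N)), 0 ≤ (if Adj ω y z then f y z else 0) := by
        intro z _; split_ifs; exacts [hf0 _ _, le_rfl]
      split_ifs with h
      · obtain ⟨z, hz, hyz⟩ := h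
        refine le_trans ?_ (Finset.single_le_sum hnn (Finset.mem_univ z))
        simp [hyz, f, hz]
      · exact Finset.sum_nonneg hnn
    rw [sum_pairs _ (fun y => by
      have : ¬ Adj ω y y := by rw [adj_iff]; simp
      simp [this])] at h3
    have h4 : ∑ e : EdgeIdx N, ((if Adj ω e.1.1 e.1.2 then f e.1.1 e.1.2 else 0) +
        (if Adj ω e.1.2 e.1.1 then f e.1.2 e.1.1 else 0)) = ∑ e, if ω e then c e else 0 := by
      apply Finset.sum_congr rfl
      intro e _
      have a1 : Adj ω e.1.1 e.1.2 ↔ ω e = true := by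
        rw [adj_iff]
        constructor
        · rintro ⟨_, h⟩; rwa [ed_lt] at h
        · intro h; exact ⟨e.2.ne, by rwa [ed_lt]⟩
      have a2 : Adj ω e.1.2 e.1.1 ↔ ω e = true := ⟨fun h => a1.1 (adj_symm h),
        fun h => adj_symm (a1.2 h)⟩
      simp only [a1, a2, c]
      split_ifs <;> simp
    rw [h4] at h3
    have := mul_le_mul_of_nonneg_left (h2.trans h3) hl
    linarith
  · rw [integral_const_mul, factor_one hw Finset.univ (fun e b => if b then exp (l * c e) else 1)]
    simp only [if_true, Bool.false_eq_true, if_false]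
    have h1 : ∏ e, (pe w e * exp (l * c e) + (1 - pe w e) * 1) ≤
        exp (∑ e, 2 * l * (pe w e * c e)) := by
      rw [exp_sum]
      apply Finset.prod_le_prod
      · intro e _
        have h1 := p_nonneg hw e.1.1 e.1.2
        have h2 := p_le_one hw e.1.1 e.1.2
        have : 0 ≤ 1 - pe w e := by unfold pe; linarith
        have : 0 ≤ pe w e := h1
        positivity
      · intro e _
        have h1 : 0 ≤ pe w e := p_nonneg hw e.1.1 e.1.2
        have hx : 0 ≤ l * c e := mul_nonneg hl (hc0 e)
        have h2 : exp (l * c e) ≤ 1 + 2 * (l * c e) := by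
          have := abs_exp_sub_one_le (x := l * c e) (by rw [abs_of_nonneg hx]; exact hc1 e)
          rw [abs_of_nonneg hx] at this
          linarith [le_abs_self (exp (l * c e) - 1)]
        refine le_trans ?_ (add_one_le_exp _)
        nlinarith
    have h2 : ∑ e, pe w e * c e ≤ κ * ∑ z ∈ H, w z := by
      have h3 : ∑ e, pe w e * c e = ∑ e : EdgeIdx N,
          ((if e.1.1 = e.1.2 then 0 else pGRG w e.1.1 e.1.2 * f e.1.1 e.1.2) +
           (if e.1.2 = e.1.1 then 0 else pGRG w e.1.2 e.1.1 * f e.1.2 e.1.1)) := by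
        apply Finset.sum_congr rfl
        intro e _
        simp only [e.2.ne, e.2.ne', if_false, c, pe, p_symm w e.1.2 e.1.1]
        ring
      rw [h3, ← sum_pairs (fun y z => if y = z then 0 else pGRG w y z * f y z) (by simp)]
      rcases H.eq_empty_or_nonempty with rfl | ⟨x0, hx0⟩
      · simp [f]
      have hW := W_pos hw x0
      calc _ ≤ ∑ y, ∑ z, (w y * w z / (∑ x, w x)) * (if z ∈ H then w y else 0) := by
            apply Finset.sum_le_sum; intro y _
            apply Finset.sum_le_sum; intro z _
            have := hw y
            have := hw z
            have h0 : 0 ≤ (w y * w z / (∑ x, w x)) * (if z ∈ H then w y else 0) := by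
              have := hf0 y z
              simp only [f] at this
              positivity
            by_cases h : y = z
            · rw [if_pos h]; exact h0
            · rw [if_neg h]; exact mul_le_mul_of_nonneg_right (p_le hw y z) (hf0 y z)
        _ = (∑ y, w y ^ 2) / (∑ x, w x) * ∑ z ∈ H, w z := by
            rw [Finset.sum_div, Finset.sum_mul_sum]
            apply Finset.sum_congr rfl; intro y _
            rw [← Finset.sum_filter_add_sum_filter_not Finset.univ (fun z => z ∈ H)]
            rw [Finset.sum_eq_zero (s := Finset.univ.filter (fun z => ¬ z ∈ H))]
            · rw [add_zero, Finset.filter_mem_eq_inter, Finset.univ_inter]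
              apply Finset.sum_congr rfl
              intro z hz
              rw [if_pos hz]; ring
            · intro z hz
              rw [if_neg (Finset.mem_filter.1 hz).2, mul_zero]
        _ ≤ κ * ∑ z ∈ H, w z := by
            apply mul_le_mul_of_nonneg_right _ (Finset.sum_nonneg fun z _ => (hw z).le)
            rw [div_le_iff₀ hW]; exact hκ
    refine (mul_le_mul_of_nonneg_left h1 (by positivity)).trans ?_
    rw [← exp_add, ← Finset.mul_sum]
    apply exp_le_exp.mpr
    nlinarith

open Classical in
/-- neighbours of `H` off `p`. -/
noncomputable def Tp (H : Finset (Fin N)) (p : Fin N) (ω : EdgeIdx N → Bool) : Finset (Fin N) :=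
  Finset.univ.filter (fun y => y ≠ p ∧ ∃ z ∈ H, z ≠ p ∧ Adj ω y z)

open Classical in
lemma lemD (hw : ∀ x, 0 < w x) (H : Finset (Fin N)) (p : Fin N) (K μ ξ qb : ℝ)
    (hμ : 0 ≤ μ) (hww : ∀ x y, w x * w y ≤ ∑ z, w z) (hp : w p ≤ (∑ z, w z) / 2)
    (hH : 2 * exp (2 * μ) * ∑ z ∈ H, w z ≤ (∑ z, w z) / 16)
    (hT : exp μ * qb ≤ (∑ z, w z) / 16) :
    (grgMeasure w).real
      {ω | ∑ y ∈ Tp H p ω, w y ≤ qb ∧ ξ ≤ (degA (Adj ω) p : ℝ) ∧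
        (degA (Adj ω) p : ℝ) ≤ 2 * (∑ y, if Adj ω p y then (if y ∈ H then 1 else 0) else 0) +
          (∑ y, if Adj ω p y then (if y ∈ Tp H p ω ∧ y ∉ H then 1 else 0) else 0) + K} ≤
      exp ((μ + log 2) * K - μ * ξ) := by
  have hpr := grg_prob hw
  set W := ∑ z, w z with hWdef
  have hW : 0 < W := W_pos hw p
  set θ := μ + log 2 with hθ
  have hθ0 : 0 ≤ θ := add_nonneg hμ (log_nonneg (by norm_num))
  let c : Finset (Fin N) → Fin N → ℝ := fun T y =>
    (μ - θ) + 2 * θ * (if y ∈ H then 1 else 0) + θ * (if y ∈ T ∧ y ∉ H then 1 else 0)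
  let 𝒯 : Finset (Finset (Fin N)) := Finset.univ.filter (fun T => ∑ y ∈ T, w y ≤ qb)
  let F : Finset (Fin N) → (EdgeIdx N → Bool) → ℝ := fun T ω => if Tp H p ω = T then 1 else 0
  have hF0 : ∀ T ω, 0 ≤ F T ω := by
    intro T ω; simp only [F]; split_ifs <;> norm_num
  refine (markov hw _ (fun ω => ∑ T ∈ 𝒯, exp (θ * K - μ * ξ) *
    (F T ω * exp (∑ y, if Adj ω p y then c T y else 0))) ?_ ?_).trans ?_
  · intro ω
    apply Finset.sum_nonneg
    intro T _
    have := hF0 T ω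
    positivity
  · rintro ω ⟨h1, h2, h3⟩
    have hmem : Tp H p ω ∈ 𝒯 := by simp only [𝒯, Finset.mem_filter, Finset.mem_univ, true_and]; exact h1
    refine le_trans ?_ (Finset.single_le_sum (f := fun T => exp (θ * K - μ * ξ) *
      (F T ω * exp (∑ y, if Adj ω p y then c T y else 0)))
      (fun T _ => by have := hF0 T ω; positivity) hmem)
    simp only [F, if_true, one_mul]
    rw [← exp_add]
    apply one_le_exp
    have h4 : (∑ y, if Adj ω p y then c (Tp H p ω) y else 0) =
        (μ - θ) * (degA (Adj ω) p : ℝ) +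
        2 * θ * (∑ y, if Adj ω p y then (if y ∈ H then 1 else 0) else 0) +
        θ * (∑ y, if Adj ω p y then (if y ∈ Tp H p ω ∧ y ∉ H then 1 else 0) else 0) := by
      rw [deg_eq_sum, Finset.mul_sum, Finset.mul_sum, ← Finset.sum_add_distrib,
        ← Finset.sum_add_distrib]
      apply Finset.sum_congr rfl
      intro y _
      by_cases h : Adj ω p y
      · simp only [h, if_true, c]
      · simp only [h, if_false]; simp
    rw [h4]
    nlinarith [mul_le_mul_of_nonneg_left h3 hθ0, mul_le_mul_of_nonneg_left h2 hμ]
  · rw [integral_finsetSum _ (fun _ _ => Integrable.of_finite)]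
    have main : ∀ T ∈ 𝒯, ∫ ω, exp (θ * K - μ * ξ) *
        (F T ω * exp (∑ y, if Adj ω p y then c T y else 0)) ∂(grgMeasure w) ≤
        exp (θ * K - μ * ξ) * ∫ ω, F T ω ∂(grgMeasure w) := by
      intro T hT'
      rw [integral_const_mul]
      apply mul_le_mul_of_nonneg_left _ (exp_pos _).le
      refine (star_factor hw p (F T) ?_ (hF0 T) (c T)).trans ?_
      · intro ω ω' h
        have : Tp H p ω = Tp H p ω' := by
          unfold Tp
          ext y
          simp only [Finset.mem_filter, Finset.mem_univ, true_and]
          apply and_congr_right; intro hy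
          apply exists_congr; intro z
          apply and_congr_right; intro _
          apply and_congr_right; intro hz
          rw [adj_iff, adj_iff]
          apply exists_congr; intro hyz
          rw [h]
          unfold star
          simp only [Finset.mem_image, Finset.mem_univ, true_and, not_exists]
          intro u hu
          rw [ed_eq_iff] at hu
          rcases hu with hu | hu
          · exact hy hu.1.symm
          · exact hz hu.1.symm
        simp only [F, this]
      · apply mul_le_of_le_one_right (integral_nonneg (hF0 T))
        apply exp_le_one_iff.mpr
        have hTq : ∑ y ∈ T, w y ≤ qb := by
          simpa only [𝒯, Finset.mem_filter, Finset.mem_univ, true_and] using hT'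
        have hc : ∀ y, exp (c T y) - 1 ≤ -(1 / 2) + 2 * exp (2 * μ) * (if y ∈ H then 1 else 0) +
            exp μ * (if y ∈ T then 1 else 0) := by
          intro y
          have e0 : exp (μ - θ) = 1 / 2 := by
            rw [hθ, show μ - (μ + log 2) = - log 2 by ring, exp_neg, exp_log (by norm_num)]; norm_num
          have e1 : exp (μ - θ + 2 * θ) = 2 * exp (2 * μ) := by
            rw [hθ, show μ - (μ + log 2) + 2 * (μ + log 2) = log 2 + 2 * μ by ring, exp_add,
              exp_log (by norm_num)]
          by_cases hyH : y ∈ H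
          · simp only [c, hyH, if_true, not_true, and_false, if_false, mul_one, mul_zero, add_zero]
            rw [e1]
            have : 0 ≤ exp μ * (if y ∈ T then (1 : ℝ) else 0) := by split_ifs <;> positivity
            linarith
          · by_cases hyT : y ∈ T
            · simp only [c, hyH, hyT, if_false, if_true, not_false_iff, and_self, mul_one, mul_zero,
                add_zero]
              rw [show μ - θ + θ = μ by ring]; linarith
            · simp only [c, hyH, hyT, if_false, false_and, mul_zero, add_zero]
              rw [e0]; norm_num
        have hpn := p_nonneg hw p
        have hwp := hw p
        have s1 : ∑ y ∈ Finset.univ.filter (fun y => p ≠ y), pGRG w p y * (exp (c T y) - 1) ≤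
            ∑ y ∈ Finset.univ.filter (fun y => p ≠ y), (-(1 / 2) * pGRG w p y +
              (2 * exp (2 * μ) * (pGRG w p y * (if y ∈ H then 1 else 0)) +
                exp μ * (pGRG w p y * (if y ∈ T then 1 else 0)))) := by
          apply Finset.sum_le_sum
          intro y _
          have := mul_le_mul_of_nonneg_left (hc y) (hpn y)
          linarith
        rw [Finset.sum_add_distrib, Finset.sum_add_distrib, ← Finset.mul_sum, ← Finset.mul_sum,
          ← Finset.mul_sum] at s1
        have s2 : w p / 4 ≤ ∑ y ∈ Finset.univ.filter (fun y => p ≠ y), pGRG w p y := by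
          have t1 : ∑ y ∈ Finset.univ.filter (fun y => p ≠ y), w p * w y / (2 * W) ≤
              ∑ y ∈ Finset.univ.filter (fun y => p ≠ y), pGRG w p y :=
            Finset.sum_le_sum fun y _ => p_ge hw p y (hww p y)
          have t2 : ∑ y ∈ Finset.univ.filter (fun y => p ≠ y), w y = W - w p := by
            rw [hWdef, Finset.filter_ne, eq_sub_iff_add_eq, Finset.sum_erase_add _ _ (Finset.mem_univ p)]
          rw [← Finset.sum_div, ← Finset.mul_sum, t2] at t1
          refine le_trans ?_ t1
          rw [div_le_div_iff₀ (by norm_num) (by positivity)]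
          nlinarith
        have s3 : ∀ U : Finset (Fin N), ∑ y ∈ Finset.univ.filter (fun y => p ≠ y),
            pGRG w p y * (if y ∈ U then 1 else 0) ≤ w p / W * ∑ y ∈ U, w y := by
          intro U
          calc _ ≤ ∑ y, pGRG w p y * (if y ∈ U then 1 else 0) := by
                apply Finset.sum_le_sum_of_subset_of_nonneg (Finset.subset_univ _)
                intro y _ _
                have := hpn y
                split_ifs <;> simp [this]
            _ = ∑ y ∈ U, pGRG w p y := by simp
            _ ≤ ∑ y ∈ U, w p / W * w y := by
                apply Finset.sum_le_sum
                intro y _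
                refine (p_le hw p y).trans (le_of_eq ?_)
                ring
            _ = _ := by rw [← Finset.mul_sum]
        have s4 := s3 H
        have s5 := s3 T
        have hr : 0 < w p / W := by positivity
        have s6 : 2 * exp (2 * μ) * (w p / W * ∑ y ∈ H, w y) ≤ w p / 16 := by
          have := mul_le_mul_of_nonneg_left hH hr.le
          have e : w p / W * (W / 16) = w p / 16 := by field_simp
          linarith
        have s7 : exp μ * (w p / W * ∑ y ∈ T, w y) ≤ w p / 16 := by
          have a := mul_le_mul_of_nonneg_left hTq (exp_pos μ).le
          have := mul_le_mul_of_nonneg_left (a.trans hT) hr.le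
          have e : w p / W * (W / 16) = w p / 16 := by field_simp
          linarith
        have s8 := mul_le_mul_of_nonneg_left s4 (by positivity : 0 ≤ 2 * exp (2 * μ))
        have s9 := mul_le_mul_of_nonneg_left s5 (exp_pos μ).le
        linarith
    refine (Finset.sum_le_sum main).trans ?_
    rw [← Finset.mul_sum, ← integral_finsetSum _ (fun _ _ => Integrable.of_finite)]
    apply mul_le_of_le_one_right (exp_pos _).le
    calc ∫ ω, ∑ T ∈ 𝒯, F T ω ∂(grgMeasure w) ≤ ∫ ω, 1 ∂(grgMeasure w) := by
          apply integral_mono Integrable.of_finite Integrable.of_finite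
          intro ω
          simp only [F]
          rw [Finset.sum_ite_eq]
          split_ifs <;> norm_num
      _ = 1 := by simp
end
end GRGP

open MeasureTheory Real
namespace GRGP
open GRG ProbabilityTheory

section
variable {N : ℕ} {w : Fin N → ℝ}

/-- one ear, explored edge by edge -/
def Ext (ω : EdgeIdx N → Bool) (Next : Finset (Fin N) → Finset (EdgeIdx N) → Prop) :
    ℕ → Finset (Fin N) → Finset (EdgeIdx N) → Fin N → Prop
  | 0 => fun _ _ _ => False
  | j + 1 => fun S E v => ∃ u, ∃ h : v ≠ u, ed v u h ∉ E ∧ ω (ed v u h) = true ∧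
      (Ext ω Next j (insert u S) (insert (ed v u h) E) u ∨
        (u ∈ S ∧ Next S (insert (ed v u h) E)))

/-- `m` ears, all started from `p` -/
def Start (ω : EdgeIdx N → Bool) (p : Fin N) (l : ℕ) :
    ℕ → Finset (Fin N) → Finset (EdgeIdx N) → Prop
  | 0 => fun _ _ => True
  | m + 1 => fun S E => Ext ω (Start ω p l m) l S E p

def AllOpen (E : Finset (EdgeIdx N)) (ω : EdgeIdx N → Bool) : Prop := ∀ e ∈ E, ω e = true

lemma allOpen_prob (hw : ∀ x, 0 < w x) (E : Finset (EdgeIdx N)) :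
    (grgMeasure w).real {ω | AllOpen E ω} ≤ ∏ e ∈ E, pe w e := by
  refine (markov hw _ (fun ω => ∏ e ∈ E, (if ω e then 1 else 0)) ?_ ?_).trans ?_
  · intro ω
    apply Finset.prod_nonneg
    intro e _; split_ifs <;> norm_num
  · intro ω hω
    apply le_of_eq
    symm
    apply Finset.prod_eq_one
    intro e he
    simp [hω e he]
  · rw [factor_one hw E (fun e b => if b then 1 else 0)]
    simp

lemma prodE_nonneg (hw : ∀ x, 0 < w x) (E : Finset (EdgeIdx N)) : 0 ≤ ∏ e ∈ E, pe w e :=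
  Finset.prod_nonneg fun _ _ => p_nonneg hw _ _

lemma ext_prob (hw : ∀ x, 0 < w x) (b κ b' : ℝ) (hb : ∀ x, w x ≤ b) (hκ1 : 1 ≤ κ) (hb' : 0 ≤ b')
    (hκ : ∑ x, w x ^ 2 ≤ κ * ∑ x, w x) (M M1 : ℕ) (hM : M1 ≤ M)
    (Next : (EdgeIdx N → Bool) → Finset (Fin N) → Finset (EdgeIdx N) → Prop)
    (hNext : ∀ S E, S.card ≤ M1 →
      (grgMeasure w).real {ω | AllOpen E ω ∧ Next ω S E} ≤ b' * ∏ e ∈ E, pe w e) :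
    ∀ (j : ℕ) (S : Finset (Fin N)) (E : Finset (EdgeIdx N)) (v : Fin N), S.card + j ≤ M1 →
      (grgMeasure w).real {ω | AllOpen E ω ∧ Ext ω (Next ω) j S E v} ≤
        w v * (j * κ ^ j * (M * b / (∑ x, w x) * b')) * ∏ e ∈ E, pe w e := by
  have hpr := grg_prob hw
  intro j
  induction j with
  | zero => intro S E v _; simp [Ext]
  | succ j ih =>
    intro S E v hS
    have hW := W_pos hw v
    set W := ∑ x, w x with hWdef
    set X := (j * κ ^ j * (M * b / W * b')) with hX
    have hbpos : 0 < b := (hw v).trans_le (hb v)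
    have hX0 : 0 ≤ X := by positivity
    have hPE := prodE_nonneg hw E
    have hsub : {ω | AllOpen E ω ∧ Ext ω (Next ω) (j + 1) S E v} ⊆
        ⋃ u : Fin N, {ω | AllOpen E ω ∧ ∃ h : v ≠ u, ed v u h ∉ E ∧ ω (ed v u h) = true ∧
      (Ext ω (Next ω) j (insert u S) (insert (ed v u h) E) u ∨
        (u ∈ S ∧ Next ω S (insert (ed v u h) E)))} := by
      rintro ω ⟨h1, u, h2⟩
      exact Set.mem_iUnion.2 ⟨u, h1, h2⟩
    refine (measureReal_mono hsub).trans ((measureReal_iUnion_fintype_le _).trans ?_)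
    have hu : ∀ u : Fin N, (grgMeasure w).real {ω | AllOpen E ω ∧ ∃ h : v ≠ u, ed v u h ∉ E ∧
        ω (ed v u h) = true ∧ (Ext ω (Next ω) j (insert u S) (insert (ed v u h) E) u ∨
        (u ∈ S ∧ Next ω S (insert (ed v u h) E)))} ≤
        (w v * w u / W) * (w u * X + if u ∈ S then b' else 0) * ∏ e ∈ E, pe w e := by
      intro u
      have h0 := hw u
      have h0' := hw v
      have hi : 0 ≤ (if u ∈ S then b' else 0) := by split_ifs; exacts [hb', le_rfl]
      have hnn : 0 ≤ (w v * w u / W) * (w u * X + if u ∈ S then b' else 0) * ∏ e ∈ E, pe w e := by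
        positivity
      by_cases hvu : v ≠ u
      swap
      · convert hnn
        convert measureReal_empty
        ext ω; simp only [Set.mem_ofPred_eq, Set.mem_empty_iff_false, iff_false]
        rintro ⟨_, h, _⟩; exact hvu h
      by_cases hE : ed v u hvu ∈ E
      · convert hnn
        convert measureReal_empty
        ext ω; simp only [Set.mem_ofPred_eq, Set.mem_empty_iff_false, iff_false]
        rintro ⟨_, h, h', _⟩; exact h' hE
      have hins : ∏ e ∈ insert (ed v u hvu) E, pe w e = pGRG w v u * ∏ e ∈ E, pe w e := by
        rw [Finset.prod_insert hE, pe_ed]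
      have hA : ∀ ω, AllOpen E ω → ω (ed v u hvu) = true → AllOpen (insert (ed v u hvu) E) ω := by
        intro ω h1 h2 e he
        rcases Finset.mem_insert.1 he with rfl | he
        · exact h2
        · exact h1 e he
      have hsub2 : {ω | AllOpen E ω ∧ ∃ h : v ≠ u, ed v u h ∉ E ∧
        ω (ed v u h) = true ∧ (Ext ω (Next ω) j (insert u S) (insert (ed v u h) E) u ∨
        (u ∈ S ∧ Next ω S (insert (ed v u h) E)))} ⊆
        {ω | AllOpen (insert (ed v u hvu) E) ω ∧
          Ext ω (Next ω) j (insert u S) (insert (ed v u hvu) E) u} ∪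
        {ω | u ∈ S ∧ AllOpen (insert (ed v u hvu) E) ω ∧ Next ω S (insert (ed v u hvu) E)} := by
        rintro ω ⟨h1, _, _, h2, h3 | h3⟩
        · left; exact ⟨hA ω h1 h2, h3⟩
        · right; exact ⟨h3.1, hA ω h1 h2, h3.2⟩
      refine (measureReal_mono hsub2).trans ((measureReal_union_le _ _).trans ?_)
      have hcard : (insert u S).card + j ≤ M1 := by
        have := Finset.card_insert_le u S
        omega
      have t1 := ih (insert u S) (insert (ed v u hvu) E) u hcard
      rw [hins] at t1
      have t2 : (grgMeasure w).real {ω | u ∈ S ∧ AllOpen (insert (ed v u hvu) E) ω ∧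
          Next ω S (insert (ed v u hvu) E)} ≤
          (if u ∈ S then b' else 0) * (pGRG w v u * ∏ e ∈ E, pe w e) := by
        by_cases huS : u ∈ S
        · simp only [huS, true_and, if_true]
          rw [← hins]
          exact hNext S _ (by omega)
        · simp [huS]
      have hp1 := p_le hw v u
      have t3 : pGRG w v u * ((w u * X + if u ∈ S then b' else 0) * ∏ e ∈ E, pe w e) ≤
          w v * w u / W * ((w u * X + if u ∈ S then b' else 0) * ∏ e ∈ E, pe w e) :=
        mul_le_mul_of_nonneg_right hp1 (by positivity)
      linarith
    refine (Finset.sum_le_sum fun u _ => hu u).trans ?_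
    rw [← Finset.sum_mul]
    apply mul_le_mul_of_nonneg_right _ hPE
    have e1 : ∑ u, (w v * w u / W) * (w u * X + if u ∈ S then b' else 0) =
        w v * ((∑ u, w u ^ 2) / W * X + (∑ u ∈ S, w u) / W * b') := by
      have : ∀ u, (w v * w u / W) * (w u * X + if u ∈ S then b' else 0) =
          w v / W * X * w u ^ 2 + w v / W * b' * (if u ∈ S then w u else 0) := by
        intro u; split_ifs <;> ring
      simp only [this]
      rw [Finset.sum_add_distrib, ← Finset.mul_sum, ← Finset.mul_sum]
      simp only [Finset.sum_ite_mem, Finset.univ_inter]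
      ring
    rw [e1]
    apply mul_le_mul_of_nonneg_left _ (hw v).le
    have e2 : (∑ u, w u ^ 2) / W ≤ κ := by rw [div_le_iff₀ hW]; exact hκ
    have e3 : (∑ u ∈ S, w u) ≤ M * b := by
      calc _ ≤ ∑ u ∈ S, b := Finset.sum_le_sum fun u _ => hb u
        _ = S.card * b := by simp
        _ ≤ M * b := by
          apply mul_le_mul_of_nonneg_right _ hbpos.le
          exact_mod_cast (by omega : S.card ≤ M)
    have e4 : (∑ u ∈ S, w u) / W * b' ≤ M * b / W * b' := by gcongr
    have e5 : (∑ u, w u ^ 2) / W * X ≤ κ * X := by gcongr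
    set Z := M * b / W * b' with hZ
    have hZ0 : 0 ≤ Z := by positivity
    have e6 : Z ≤ κ ^ (j + 1) * Z := le_mul_of_one_le_left hZ0 (one_le_pow₀ hκ1)
    calc _ ≤ κ * X + Z := add_le_add e5 e4
      _ ≤ κ * X + κ ^ (j + 1) * Z := by linarith
      _ = _ := by rw [hX]; push_cast; ring

lemma start_prob (hw : ∀ x, 0 < w x) (b κ : ℝ) (hb : ∀ x, w x ≤ b) (hκ1 : 1 ≤ κ)
    (hκ : ∑ x, w x ^ 2 ≤ κ * ∑ x, w x) (M l : ℕ) (p : Fin N) :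
    ∀ (m : ℕ) (S : Finset (Fin N)) (E : Finset (EdgeIdx N)), S.card + m * l ≤ M →
      (grgMeasure w).real {ω | AllOpen E ω ∧ Start ω p l m S E} ≤
        (l * κ ^ l * M * (b ^ 2 / (∑ x, w x))) ^ m * ∏ e ∈ E, pe w e := by
  intro m
  have hW := W_pos hw p
  have hbpos : 0 < b := (hw p).trans_le (hb p)
  induction m with
  | zero =>
    intro S E _
    simp only [Start, and_true, pow_zero, one_mul]
    exact allOpen_prob hw E
  | succ m ih =>
    intro S E hS
    have hS' : S.card + l + m * l ≤ M := by rw [add_mul] at hS; omega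
    have h := ext_prob hw b κ ((l * κ ^ l * M * (b ^ 2 / (∑ x, w x))) ^ m) hb hκ1 (by positivity)
      hκ M (M - m * l) (by omega) (fun ω => Start ω p l m)
      (fun S E hS => ih S E (by omega)) l S E p (by omega)
    simp only [Start]
    refine h.trans ?_
    apply mul_le_mul_of_nonneg_right _ (prodE_nonneg hw E)
    calc _ ≤ b * (l * κ ^ l * (M * b / (∑ x, w x) * (l * κ ^ l * M * (b ^ 2 / (∑ x, w x))) ^ m)) := by
          apply mul_le_mul_of_nonneg_right (hb p); positivity
      _ = _ := by ring

lemma walk_ext (ω : EdgeIdx N → Bool) (p : Fin N) (L : ℕ) (γ : ℕ → Fin N) (hL : 3 ≤ L)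
    (hγL : γ L = p) (hpath : IsPathOn (Adj ω) L γ) (hs : IsSimplePath L γ)
    (Next : Finset (Fin N) → Finset (EdgeIdx N) → Prop) (n : ℕ)
    (hNext : ∀ (S : Finset (Fin N)) (E : Finset (EdgeIdx N)), p ∈ S →
      (∀ e ∈ E, e.1.1 ∈ S ∧ e.1.2 ∈ S) → E.card ≤ n → Next S E) :
    ∀ (j i : ℕ) (S : Finset (Fin N)) (E : Finset (EdgeIdx N)), i < L → L ≤ i + j → p ∈ S →
      γ i ∈ S → (∀ e ∈ E, e.1.1 ∈ S ∧ e.1.2 ∈ S) → E.card + j ≤ n →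
      (∀ h, ed (γ i) (γ (i + 1)) h ∉ E) → Ext ω Next j S E (γ i) := by
  intro j
  induction j with
  | zero => intro i S E h1 h2; omega
  | succ j ih =>
    intro i S E h1 h2 hp hi hE hc hf
    obtain ⟨hne, hopen⟩ := (adj_iff _ _ _).1 (hpath i h1)
    refine ⟨γ (i + 1), hne, hf hne, hopen, ?_⟩
    have hEi : ∀ S' : Finset (Fin N), S ⊆ S' → γ (i + 1) ∈ S' →
        ∀ e ∈ insert (ed (γ i) (γ (i + 1)) hne) E, e.1.1 ∈ S' ∧ e.1.2 ∈ S' := by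
      intro S' hSS hu e he
      rcases Finset.mem_insert.1 he with rfl | he
      · unfold ed
        split_ifs
        · exact ⟨hSS hi, hu⟩
        · exact ⟨hu, hSS hi⟩
      · exact ⟨hSS (hE e he).1, hSS (hE e he).2⟩
    have hcard := Finset.card_insert_le (ed (γ i) (γ (i + 1)) hne) E
    by_cases hu : γ (i + 1) ∈ S
    · right
      exact ⟨hu, hNext _ _ hp (hEi S subset_rfl hu) (by omega)⟩
    · left
      have hlt : i + 1 < L := by
        rcases lt_or_eq_of_le (Nat.succ_le_of_lt h1) with h | h
        · exact h
        · exfalso; apply hu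
          have : i + 1 = L := h
          rw [this, hγL]; exact hp
      apply ih (i + 1) _ _ hlt (by omega) (Finset.mem_insert_of_mem hp)
        (Finset.mem_insert_self _ _) (hEi _ (Finset.subset_insert _ _) (Finset.mem_insert_self _ _))
        (by omega)
      intro h hmem
      rcases Finset.mem_insert.1 hmem with hmem | hmem
      · rw [ed_eq_iff] at hmem
        rcases hmem with hm | hm
        · exact hne hm.1.symm
        · exact hs i (i + 1 + 1) (by omega) (by omega) (by omega) hm.2.symm
      · have := hE _ hmem
        unfold ed at this
        split_ifs at this
        · exact hu this.1
        · exact hu this.2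

lemma start_of_cyc (ω : EdgeIdx N → Bool) (p : Fin N) (r : ℕ) :
    ∀ (m : ℕ) (S : Finset (Fin N)) (E : Finset (EdgeIdx N)), p ∈ S →
      (∀ e ∈ E, e.1.1 ∈ S ∧ e.1.2 ∈ S) →
      E.card + m * (2 * r + 1) ≤ (S1cycA (Adj ω) r p).ncard → Start ω p (2 * r + 1) m S E := by
  intro m
  induction m with
  | zero => intro S E _ _ _; trivial
  | succ m ih =>
    intro S E hp hE hc
    rw [add_mul] at hc
    have hex : ∃ y ∈ S1cycA (Adj ω) r p, ∀ h, ed p y h ∉ E := by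
      by_contra hcon
      push Not at hcon
      have hsub : S1cycA (Adj ω) r p ⊆
          ((E.image fun e => if e.1.1 = p then e.1.2 else e.1.1 : Finset (Fin N)) : Set (Fin N)) := by
        intro y hy
        obtain ⟨h, hmem⟩ := hcon y hy
        simp only [Finset.coe_image, Set.mem_image, Finset.mem_coe]
        refine ⟨_, hmem, ?_⟩
        unfold ed
        split_ifs with h1 h2 h2
        · rfl
        · exact (h2 rfl).elim
        · exact h2.symm
        · rfl
      have h1 := Set.ncard_le_ncard hsub (Finset.finite_toSet _)
      rw [Set.ncard_coe_finset] at h1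
      have h2 := Finset.card_image_le (s := E) (f := fun e => if e.1.1 = p then e.1.2 else e.1.1)
      omega
    obtain ⟨y, ⟨_, L, γ, hL3, hL, h0, h1, hLp, hpath, hs⟩, hf⟩ := hex
    have := walk_ext ω p L γ hL3 hLp hpath hs (Start ω p (2 * r + 1) m) (E.card + (2 * r + 1))
      (fun S' E' hp' hE' hc' => ih S' E' hp' hE' (by omega)) (2 * r + 1) 0 S E (by omega) (by omega)
      hp (by rw [h0]; exact hp) hE le_rfl (by
        rw [h0, h1]; exact hf)
    rw [h0] at this
    exact this

lemma cyc_prob (hw : ∀ x, 0 < w x) (b κ : ℝ) (hb : ∀ x, w x ≤ b) (hκ1 : 1 ≤ κ)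
    (hκ : ∑ x, w x ^ 2 ≤ κ * ∑ x, w x) (r m : ℕ) (p : Fin N) :
    (grgMeasure w).real {ω | m * (2 * r + 1) ≤ (S1cycA (Adj ω) r p).ncard} ≤
      (((2 * r + 1 : ℕ) : ℝ) * κ ^ (2 * r + 1) * ((1 + m * (2 * r + 1) : ℕ) : ℝ) *
        (b ^ 2 / (∑ x, w x))) ^ m := by
  have hpr := grg_prob hw
  have h := start_prob hw b κ hb hκ1 hκ (1 + m * (2 * r + 1)) (2 * r + 1) p m {p} ∅ (by simp)
  rw [Finset.prod_empty, mul_one] at h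
  refine le_trans (measureReal_mono ?_) h
  intro ω hω
  refine ⟨by intro e he; simp at he, ?_⟩
  apply start_of_cyc ω p r m {p} ∅ (by simp) (by simp)
  simpa using hω

lemma cyc_symm (ω : EdgeIdx N → Bool) (r : ℕ) (p y : Fin N) (h : p ∈ S1cycA (Adj ω) r y) :
    y ∈ S1cycA (Adj ω) r p := by
  obtain ⟨hadj, l, γ, h3, hl, h0, h1, hll, hpath, hs⟩ := h
  refine ⟨adj_symm hadj, l, fun i => if i = 0 then γ 1 else γ (l + 1 - i), h3, hl, ?_, ?_, ?_, ?_, ?_⟩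
  · simpa using h1
  · simpa using hll
  · simp only [show l ≠ 0 by omega, if_false]
    rw [show l + 1 - l = 1 by omega, h1]
  · intro i hi
    by_cases hi0 : i = 0
    · subst hi0
      simp only [if_true, zero_add, one_ne_zero, if_false]
      rw [show l + 1 - 1 = l by omega, hll, h1]
      exact adj_symm hadj
    · simp only [hi0, if_false, show i + 1 ≠ 0 by omega]
      have := hpath (l - i) (by omega)
      rw [show l + 1 - i = l - i + 1 by omega, show l + 1 - (i + 1) = l - i by omega]
      exact adj_symm this
  · intro i j hij hj hn
    by_cases hi0 : i = 0
    · subst hi0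
      simp only [if_true, show j ≠ 0 by omega, if_false]
      exact hs 1 (l + 1 - j) (by omega) (by omega) (by omega)
    · simp only [hi0, if_false, show j ≠ 0 by omega]
      exact (hs (l + 1 - j) (l + 1 - i) (by omega) (by omega) (by omega)).symm
end
end GRGP

open MeasureTheory Real
namespace GRGP
open GRG ProbabilityTheory

section
variable {N : ℕ} {w : Fin N → ℝ}

open Classical in
lemma det (ω : EdgeIdx N → Bool) (r : ℕ) (H : Finset (Fin N)) (ξ K : ℝ) (x p : Fin N)
    (hx : ξ ≤ (degA (Adj ω) x : ℝ)) (hadj : AdjPA (Adj ω) r x p) (hxp : precA (Adj ω) x p)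
    (hE1 : ∀ z, ξ ≤ (degA (Adj ω) z : ℝ) → z ∈ H)
    (hcyc : ((S1cycA (Adj ω) r p).ncard : ℝ) ≤ K)
    (hD : 2 * (∑ y, if Adj ω p y then (if y ∈ H then 1 else 0) else 0) +
          (∑ y, if Adj ω p y then (if y ∈ Tp H p ω ∧ y ∉ H then 1 else 0) else 0) + K <
          (degA (Adj ω) p : ℝ)) :
    (degPA (Adj ω) r p : ℝ) / 2 ≤ ((SibmA (Adj ω) r x).ncard : ℝ) := by
  have hDp : ξ ≤ (degA (Adj ω) p : ℝ) := by
    refine hx.trans ?_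
    rcases hxp with h | h
    · exact_mod_cast h.le
    · exact_mod_cast h.1.le
  -- small degree vertices are smaller than both
  have hsmall : ∀ y, y ∉ H → precA (Adj ω) y x ∧ precA (Adj ω) y p ∧ ¬ precA (Adj ω) p y := by
    intro y hy
    have h1 : (degA (Adj ω) y : ℝ) < ξ := by
      by_contra h; exact hy (hE1 y (not_lt.1 h))
    have h2 : degA (Adj ω) y < degA (Adj ω) x := by exact_mod_cast h1.trans_le hx
    have h3 : degA (Adj ω) y < degA (Adj ω) p := by exact_mod_cast h1.trans_le hDp
    refine ⟨Or.inl h2, Or.inl h3, ?_⟩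
    rintro (h | h) <;> omega
  let A1 := Finset.univ.filter (fun y => Adj ω p y ∧ y ∈ H)
  let B1 := Finset.univ.filter (fun y => Adj ω p y ∧ y ∈ Tp H p ω ∧ y ∉ H)
  have ha : (∑ y, if Adj ω p y then (if y ∈ H then (1:ℝ) else 0) else 0) = A1.card := by
    simp only [← ite_and]
    simp [A1]
  have hb : (∑ y, if Adj ω p y then (if y ∈ Tp H p ω ∧ y ∉ H then (1:ℝ) else 0) else 0)
      = B1.card := by
    simp only [← ite_and]
    simp [B1]
  rw [ha, hb] at hD
  have hP : {y | AdjPA (Adj ω) r p y} ⊆ SibmA (Adj ω) r x ∪ (A1 : Set (Fin N)) := by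
    intro y hy
    have hy' : AdjPA (Adj ω) r p y := hy
    by_cases hyH : y ∈ H
    · right; simp [A1, hyH, hy'.1.1]
    · left
      exact ⟨p, hadj, hxp, hy', (hsmall y hyH).2.1, (hsmall y hyH).1⟩
  have hNb : {y | Adj ω p y} ⊆ (SibmA (Adj ω) r x ∪ (A1 : Set (Fin N))) ∪ ((B1 : Set (Fin N)) ∪
      S1cycA (Adj ω) r p) := by
    intro y hy
    have hy' : Adj ω p y := hy
    by_cases hyH : y ∈ H
    · left; right; simp [A1, hyH, hy']
    by_cases hyc : y ∈ S1cycA (Adj ω) r p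
    · right; right; exact hyc
    by_cases hyT : y ∈ Tp H p ω
    · right; left; simp [B1, hyH, hy', hyT]
    left; left
    refine ⟨p, hadj, hxp, ⟨⟨hy', hyc, fun h => hyc (cyc_symm ω r p y h)⟩, ?_, ?_⟩,
      (hsmall y hyH).2.1, (hsmall y hyH).1⟩
    · rintro ⟨_, _, _, z, hyz, _, hpz⟩
      apply hyT
      simp only [Tp, Finset.mem_filter, Finset.mem_univ, true_and]
      refine ⟨?_, z, ?_, ?_, hyz⟩
      · rintro rfl
        obtain ⟨h, _⟩ := (adj_iff _ _ _).1 hy'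
        exact h rfl
      · apply hE1
        refine hDp.trans ?_
        rcases hpz with h | h
        · exact_mod_cast h.le
        · exact_mod_cast h.1.le
      · rintro rfl
        rcases hpz with h | h
        · omega
        · exact lt_irrefl _ h.2
    · rintro ⟨_, _, h, _⟩
      exact (hsmall y hyH).2.2 h
  have c1 : degPA (Adj ω) r p ≤ (SibmA (Adj ω) r x).ncard + A1.card := by
    have h1 := Set.ncard_le_ncard hP (Set.toFinite _)
    have h2 := Set.ncard_union_le (SibmA (Adj ω) r x) (A1 : Set (Fin N))
    rw [Set.ncard_coe_finset] at h2
    exact h1.trans h2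
  have c2 : degA (Adj ω) p ≤ (SibmA (Adj ω) r x).ncard + A1.card + (B1.card +
      (S1cycA (Adj ω) r p).ncard) := by
    have h1 := Set.ncard_le_ncard hNb (Set.toFinite _)
    have h2 := Set.ncard_union_le (SibmA (Adj ω) r x) (A1 : Set (Fin N))
    have h3 := Set.ncard_union_le (B1 : Set (Fin N)) (S1cycA (Adj ω) r p)
    have h4 := Set.ncard_union_le (SibmA (Adj ω) r x ∪ (A1 : Set (Fin N))) ((B1 : Set (Fin N)) ∪
      S1cycA (Adj ω) r p)
    rw [Set.ncard_coe_finset] at h2 h3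
    have h5 : degA (Adj ω) p = {y | Adj ω p y}.ncard := rfl
    omega
  have c1' : (degPA (Adj ω) r p : ℝ) ≤ (SibmA (Adj ω) r x).ncard + A1.card := by exact_mod_cast c1
  have c2' : (degA (Adj ω) p : ℝ) ≤ (SibmA (Adj ω) r x).ncard + A1.card + (B1.card +
      (S1cycA (Adj ω) r p).ncard) := by exact_mod_cast c2
  linarith
end
end GRGP

open MeasureTheory Real
namespace GRGP
open GRG ProbabilityTheory
section
variable {N : ℕ} {w : Fin N → ℝ}

lemma heavy_sum (hw : ∀ x, 0 < w x) (κ t : ℝ) (ht : 0 < t)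
    (hκ : ∑ x, w x ^ 2 ≤ κ * ∑ x, w x) :
    ∑ z ∈ Finset.univ.filter (fun z => t ≤ w z), w z ≤ κ / t * ∑ x, w x := by
  have h1 : t * ∑ z ∈ Finset.univ.filter (fun z => t ≤ w z), w z ≤ ∑ x, w x ^ 2 := by
    rw [Finset.mul_sum]
    refine le_trans (Finset.sum_le_sum (f := fun z => t * w z) (g := fun z => w z ^ 2) ?_)
      (Finset.sum_le_sum_of_subset_of_nonneg (Finset.filter_subset _ _) (fun i _ _ => by positivity))
    intro z hz
    have := (Finset.mem_filter.1 hz).2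
    have := hw z
    show t * w z ≤ w z ^ 2
    nlinarith
  have h2 := h1.trans hκ
  rw [div_mul_eq_mul_div, le_div_iff₀ ht]
  linarith

lemma finite_bound (hw : ∀ x, 0 < w x) (b κ t μ ξ a l : ℝ) (m r : ℕ)
    (hb : ∀ x, w x ≤ b) (hκ1 : 1 ≤ κ) (hκ : ∑ x, w x ^ 2 ≤ κ * ∑ x, w x)
    (ht : 0 < t) (hl : 0 ≤ l) (hlb : l * (2 * b) ≤ 1) (hμ : 0 ≤ μ)
    (hww : ∀ x y, w x * w y ≤ ∑ z, w z) (hp : ∀ p, w p ≤ (∑ z, w z) / 2)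
    (hH : 2 * exp (2 * μ) * (κ / t) ≤ 1 / 16) (hT : exp μ * a ≤ 1 / 16) :
    (grgMeasure w).real {ω | ∀ x : Fin N, ξ ≤ (degA (Adj ω) x : ℝ) →
          ∀ p : Fin N, AdjPA (Adj ω) r x p → precA (Adj ω) x p →
            (degPA (Adj ω) r p : ℝ) / 2 ≤ ((SibmA (Adj ω) r x).ncard : ℝ)}ᶜ ≤
      N * exp (t * exp μ - μ * ξ) + exp (l * ((2 * (κ * (κ / t)) - a) * ∑ z, w z)) +
      N * (((2 * r + 1 : ℕ) : ℝ) * κ ^ (2 * r + 1) * ((1 + m * (2 * r + 1) : ℕ) : ℝ) *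
        (b ^ 2 / (∑ x, w x))) ^ m +
      N * exp ((μ + log 2) * ((m * (2 * r + 1) : ℕ) : ℝ) - μ * ξ) := by
  classical
  have hpr := grg_prob hw
  have hW0 : 0 ≤ ∑ z, w z := Finset.sum_nonneg (fun z _ => (hw z).le)
  set H : Finset (Fin N) := Finset.univ.filter (fun z => t ≤ w z) with hHdef
  have hHs : ∑ z ∈ H, w z ≤ κ / t * ∑ x, w x := heavy_sum hw κ t ht hκ
  set W := ∑ z, w z with hWdef
  set K : ℝ := ((m * (2 * r + 1) : ℕ) : ℝ) with hK
  let B1 : Fin N → Set (EdgeIdx N → Bool) := fun z => {ω | w z < t ∧ ξ ≤ (degA (Adj ω) z : ℝ)}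
  let B2 : Set (EdgeIdx N → Bool) :=
    {ω | a * W ≤ ∑ y ∈ Finset.univ.filter (fun y => ∃ z ∈ H, Adj ω y z), w y}
  let B3 : Fin N → Set (EdgeIdx N → Bool) :=
    fun p => {ω | m * (2 * r + 1) ≤ (S1cycA (Adj ω) r p).ncard}
  let B4 : Fin N → Set (EdgeIdx N → Bool) := fun p =>
    {ω | ∑ y ∈ Tp H p ω, w y ≤ a * W ∧ ξ ≤ (degA (Adj ω) p : ℝ) ∧
        (degA (Adj ω) p : ℝ) ≤ 2 * (∑ y, if Adj ω p y then (if y ∈ H then 1 else 0) else 0) +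
          (∑ y, if Adj ω p y then (if y ∈ Tp H p ω ∧ y ∉ H then 1 else 0) else 0) + K}
  have b1 : ∀ z, (grgMeasure w).real (B1 z) ≤ exp (t * exp μ - μ * ξ) := by
    intro z
    by_cases hz : w z < t
    · refine (measureReal_mono (fun ω hω => hω.2)).trans ((lemA hw z μ ξ hμ).trans ?_)
      apply exp_le_exp.mpr
      have := exp_pos μ
      nlinarith
    · have : B1 z = ∅ := by ext ω; simp [B1, hz]
      rw [this]; simp; positivity
  have b2 : (grgMeasure w).real B2 ≤ exp (l * ((2 * (κ * (κ / t)) - a) * W)) := by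
    refine (lemB hw H κ l (a * W) b hl hb hlb hκ).trans (exp_le_exp.mpr ?_)
    apply mul_le_mul_of_nonneg_left _ hl
    have : κ * ∑ z ∈ H, w z ≤ κ * (κ / t * W) := mul_le_mul_of_nonneg_left hHs (by linarith)
    nlinarith
  have b3 := fun p => cyc_prob hw b κ hb hκ1 hκ r m p
  have b4 : ∀ p, (grgMeasure w).real (B4 p) ≤ exp ((μ + log 2) * K - μ * ξ) := by
    intro p
    apply lemD hw H p K μ ξ (a * W) hμ hww (hp p)
    · have h1 := mul_le_mul_of_nonneg_left hHs (by positivity : 0 ≤ 2 * exp (2 * μ))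
      have h2 := mul_le_mul_of_nonneg_right hH hW0
      linarith
    · have h2 := mul_le_mul_of_nonneg_right hT hW0
      linarith
  have sumc : ∀ (B : Fin N → Set (EdgeIdx N → Bool)) (c : ℝ),
      (∀ p, (grgMeasure w).real (B p) ≤ c) → (grgMeasure w).real (⋃ p, B p) ≤ N * c := by
    intro B c h
    refine (measureReal_iUnion_fintype_le B).trans ((Finset.sum_le_sum (fun p _ => h p)).trans ?_)
    simp
  have hsub : {ω | ∀ x : Fin N, ξ ≤ (degA (Adj ω) x : ℝ) →
          ∀ p : Fin N, AdjPA (Adj ω) r x p → precA (Adj ω) x p →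
            (degPA (Adj ω) r p : ℝ) / 2 ≤ ((SibmA (Adj ω) r x).ncard : ℝ)}ᶜ ⊆
      (⋃ z, B1 z) ∪ B2 ∪ (⋃ p, B3 p) ∪ (⋃ p, B4 p) := by
    intro ω hω
    by_contra hn
    apply hω
    simp only [Set.mem_union, Set.mem_iUnion, not_or, not_exists] at hn
    obtain ⟨⟨⟨n1, n2⟩, n3⟩, n4⟩ := hn
    intro x hx p hadj hxp
    refine det ω r H ξ K x p hx hadj hxp ?_ ?_ ?_
    · intro z hz
      rw [hHdef, Finset.mem_filter]
      refine ⟨Finset.mem_univ _, ?_⟩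
      by_contra hlt
      exact n1 z ⟨not_le.1 hlt, hz⟩
    · have h := n3 p
      simp only [B3, Set.mem_ofPred_eq, not_le] at h
      rw [hK]
      exact_mod_cast h.le
    · by_contra hlt
      apply n4 p
      refine ⟨?_, ?_, not_lt.1 hlt⟩
      · simp only [B2, Set.mem_ofPred_eq, not_le] at n2
        refine le_trans (Finset.sum_le_sum_of_subset_of_nonneg ?_ (fun i _ _ => (hw i).le)) n2.le
        intro y hy
        simp only [Tp, Finset.mem_filter, Finset.mem_univ, true_and] at hy ⊢
        obtain ⟨_, z, hz, _, h⟩ := hy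
        exact ⟨z, hz, h⟩
      · refine hx.trans ?_
        rcases hxp with h | h
        · exact_mod_cast h.le
        · exact_mod_cast h.1.le
  refine (measureReal_mono hsub).trans ?_
  refine (measureReal_union_le _ _).trans (add_le_add ?_ (sumc _ _ b4))
  refine (measureReal_union_le _ _).trans (add_le_add ?_ (sumc _ _ b3))
  exact (measureReal_union_le _ _).trans (add_le_add (sumc _ _ b1) b2)
end
end GRGP

open MeasureTheory Real
namespace GRGP
open GRG ProbabilityTheory
section
open Filter

lemma ev_rpow (a A : ℝ) (ha : 0 < a) (η : ℝ) (hη : 0 < η) :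
    ∀ᶠ L : ℝ in atTop, A * L ^ (-a) ≤ η := by
  have h := (tendsto_rpow_neg_atTop ha).const_mul A
  rw [mul_zero] at h
  exact h.eventually (eventually_le_nhds hη)

lemma ev_exp (k : ℝ) (n : ℕ) (A : ℝ) (hk : 0 < k) :
    ∀ᶠ L : ℝ in atTop, A * L ^ n ≤ exp (k * L) := by
  have h := isLittleO_pow_exp_pos_mul_atTop (n) hk
  have h2 := h.bound (c := 1 / (|A| + 1)) (by positivity)
  filter_upwards [h2, eventually_ge_atTop 0] with L hL h0
  rw [norm_of_nonneg (by positivity), norm_of_nonneg (by positivity), div_mul_eq_mul_div, one_mul,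
    le_div_iff₀ (by positivity)] at hL
  refine le_trans ?_ hL
  have : A * L ^ n ≤ |A| * L ^ n := mul_le_mul_of_nonneg_right (le_abs_self A) (by positivity)
  have : 0 ≤ L ^ n := by positivity
  linarith

lemma ev_log (A B η : ℝ) (hη : 0 < η) :
    ∀ᶠ L : ℝ in atTop, A * log L + B ≤ η * L := by
  have h := Real.isLittleO_log_id_atTop
  have h2 := h.bound (c := η / 2 / (|A| + 1)) (by positivity)
  filter_upwards [h2, eventually_ge_atTop 1, eventually_ge_atTop (2 * B / η)] with L hL h0 hB
  rw [norm_of_nonneg (log_nonneg h0), id, norm_of_nonneg (by positivity), div_mul_eq_mul_div,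
    le_div_iff₀ (by positivity)] at hL
  rw [div_le_iff₀ hη] at hB
  have : 0 ≤ log L := log_nonneg h0
  have : A * log L ≤ |A| * log L := mul_le_mul_of_nonneg_right (le_abs_self A) (by positivity)
  nlinarith

/-- purely real estimates; `s = 1/3 - δ`, `L = log N`. -/
lemma eventual (s C ν ε c D : ℝ) (m n : ℕ) (hs : 0 < s) (hs' : s < 1 / 3) (hC : 1 ≤ C)
    (hν : 0 < ν) (hε : 0 < ε) (hc : 6 * (ν + 1) ≤ c) (hm : 2 * (ν + 1) ≤ ε * m) (K : ℝ) (hD : 0 ≤ D) :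
    ∀ᶠ L : ℝ in atTop, 3 ≤ L ∧ 0 < log L ∧
      2 * exp (2 * ((1 / 6 + s / 4) * log L)) * (C * L ^ (1 / 3 - s) / L ^ (5 / 6 - s / 2)) ≤ 1 / 16 ∧
      exp ((1 / 6 + s / 4) * log L) * L ^ (-(1 / 6 + s)) ≤ 1 / 16 ∧
      exp L * exp (L ^ (5 / 6 - s / 2) * exp ((1 / 6 + s / 4) * log L) -
        ((1 / 6 + s / 4) * log L) * (c * (L / log L))) ≤ exp (-ν * L) ∧
      (∀ R, exp (L / 2) / 2 ≤ R → exp (R * (2 * (C * L ^ (1 / 3 - s) *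
        (C * L ^ (1 / 3 - s) / L ^ (5 / 6 - s / 2))) - L ^ (-(1 / 6 + s)))) ≤ exp (-ν * L)) ∧
      (∀ R, 0 ≤ R → R ≤ exp (-ε * L) → exp L * (D * (C * L ^ (1 / 3 - s)) ^ n * R) ^ m
        ≤ exp (-ν * L)) ∧
      exp L * exp (((1 / 6 + s / 4) * log L + log 2) * K -
        ((1 / 6 + s / 4) * log L) * (c * (L / log L))) ≤ exp (-ν * L) := by
  have hη : 0 < (ν + 1) * s := by positivity
  filter_upwards [eventually_ge_atTop 3, ev_rpow (s / 4) 1 (by positivity) _ hη,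
    ev_rpow (s / 2) (C ^ 2) (by positivity) (1 / 4) (by norm_num),
    ev_rpow (1 / 6) (2 * C) (by positivity) (1 / 16) (by norm_num),
    ev_rpow (3 * s / 4) 1 (by positivity) (1 / 16) (by norm_num),
    ev_exp (1 / 2) 2 (4 * ν) (by norm_num), ev_exp (ε / 2) n (D * C ^ n) (by positivity),
    ev_log ((1 / 6 + s / 4) * K) (log 2 * K) _ hη] with L f1 f2 f3 f4 f5 f6 f7 f8
  have hL0 : 0 < L := by linarith
  have hlog : 0 < log L := log_pos (by linarith)
  have hexp : ∀ x : ℝ, exp (x * log L) = L ^ x := fun x => by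
    rw [rpow_def_of_pos hL0, mul_comm]
  have hcg : (ν + 1) + (ν + 1) * s ≤ (1 / 6 + s / 4) * c := by
    have := mul_le_mul_of_nonneg_left hc (by positivity : 0 ≤ 1 / 6 + s / 4)
    nlinarith
  have hmx : ((1 / 6 + s / 4) * log L) * (c * (L / log L)) = (1 / 6 + s / 4) * c * L := by
    field_simp
  have hcgL : (ν + 1) * L + (ν + 1) * s * L ≤ (1 / 6 + s / 4) * c * L := by nlinarith
  have hpos : ∀ x : ℝ, 0 < L ^ x := fun x => rpow_pos_of_pos hL0 x
  refine ⟨f1, hlog, ?_, ?_, ?_, ?_, ?_, ?_⟩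
  · rw [← mul_assoc 2 (1 / 6 + s / 4), hexp, mul_div_assoc, ← rpow_sub hL0]
    calc _ = 2 * C * (L ^ (2 * (1 / 6 + s / 4)) * L ^ (1 / 3 - s - (5 / 6 - s / 2))) := by ring
      _ = 2 * C * L ^ (-(1 / 6) : ℝ) := by rw [← rpow_add hL0]; congr 2; ring
      _ ≤ _ := f4
  · rw [hexp, ← rpow_add hL0]
    rw [one_mul] at f5
    convert f5 using 2; ring
  · rw [hmx, hexp, ← rpow_add hL0, ← exp_add]
    apply exp_le_exp.mpr
    have : L ^ (5 / 6 - s / 2 + (1 / 6 + s / 4)) = L ^ (-(s / 4)) * L := by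
      rw [← rpow_add_one hL0.ne']; congr 1; ring
    rw [this]
    rw [one_mul] at f2
    nlinarith [mul_le_mul_of_nonneg_right f2 hL0.le]
  · intro R hR
    apply exp_le_exp.mpr
    have e1 : C * L ^ (1 / 3 - s) * (C * L ^ (1 / 3 - s) / L ^ (5 / 6 - s / 2)) =
        C ^ 2 * L ^ (-(s / 2)) * L ^ (-(1 / 6 + s)) := by
      rw [mul_div_assoc, ← rpow_sub hL0]
      have : L ^ (-(s / 2)) * L ^ (-(1 / 6 + s)) = L ^ (1 / 3 - s) * L ^ (1 / 3 - s - (5 / 6 - s / 2)) := by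
        rw [← rpow_add hL0, ← rpow_add hL0]; congr 1; ring
      rw [mul_assoc (C ^ 2), this]; ring
    rw [e1]
    have e2 : L⁻¹ ≤ L ^ (-(1 / 6 + s)) := by
      rw [← rpow_neg_one]
      exact rpow_le_rpow_of_exponent_le (by linarith) (by linarith)
    have e3 : C ^ 2 * L ^ (-(s / 2)) * L ^ (-(1 / 6 + s)) ≤ 1 / 4 * L ^ (-(1 / 6 + s)) :=
      mul_le_mul_of_nonneg_right f3 (hpos _).le
    have e4 : 2 * (C ^ 2 * L ^ (-(s / 2)) * L ^ (-(1 / 6 + s))) - L ^ (-(1 / 6 + s)) ≤ - (L⁻¹ / 2) := by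
      linarith
    have hR2 : 2 * ν * L ^ 2 ≤ R := by
      rw [show L / 2 = 1 / 2 * L by ring] at hR
      linarith
    have hR0 : 0 ≤ R := le_trans (by positivity) hR2
    calc _ ≤ R * (-(L⁻¹ / 2)) := mul_le_mul_of_nonneg_left e4 hR0
      _ = - (R * (L⁻¹ / 2)) := by ring
      _ ≤ - (2 * ν * L ^ 2 * (L⁻¹ / 2)) := by
        apply neg_le_neg
        exact mul_le_mul_of_nonneg_right hR2 (by positivity)
      _ = -ν * L := by field_simp
  · intro R hR0 hR
    have g1 : (C * L ^ (1 / 3 - s)) ^ n ≤ C ^ n * L ^ n := by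
      rw [← mul_pow]
      apply pow_le_pow_left₀ (mul_nonneg (by linarith) (hpos _).le)
      apply mul_le_mul_of_nonneg_left _ (by linarith)
      conv_rhs => rw [← rpow_one L]
      exact rpow_le_rpow_of_exponent_le (by linarith) (by linarith)
    have g2 : D * (C * L ^ (1 / 3 - s)) ^ n ≤ exp (ε / 2 * L) := by
      refine le_trans (mul_le_mul_of_nonneg_left g1 hD) ?_
      rw [← mul_assoc]; exact f7
    have hk0 : 0 ≤ (C * L ^ (1 / 3 - s)) ^ n := pow_nonneg (mul_nonneg (by linarith) (hpos _).le) n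
    have g3 : D * (C * L ^ (1 / 3 - s)) ^ n * R ≤ exp (-(ε / 2) * L) := by
      refine (mul_le_mul g2 hR hR0 (exp_pos _).le).trans ?_
      rw [← exp_add]; apply le_of_eq; congr 1; ring
    have g4 := pow_le_pow_left₀ (mul_nonneg (mul_nonneg hD hk0) hR0) g3 m
    rw [← exp_nat_mul] at g4
    refine (mul_le_mul_of_nonneg_left g4 (exp_pos L).le).trans ?_
    rw [← exp_add]
    apply exp_le_exp.mpr
    nlinarith
  · rw [hmx, ← exp_add]
    apply exp_le_exp.mpr
    linarith

end
end GRGP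

open MeasureTheory Real
namespace GRGP
open GRG ProbabilityTheory
section
open Filter

set_option maxHeartbeats 2000000 in
lemma large_N (ε δ : ℝ) (hε : 0 < ε) (hε' : ε < 1 / 2) (hδ : 0 < δ) (hδ' : δ < 1 / 3)
    (r : ℕ)
    (w : (N : ℕ) → Fin N → ℝ)
    (hpos : ∀ N x, 0 < w N x)
    (hA1 : ∀ N x, w N x ≤ (N : ℝ) ^ ((1 : ℝ) / 2 - ε))
    (hA2m1 : ∀ N : ℕ, 1 ≤ N → (N : ℝ) ^ (-ε) ≤ m1 (w N))
    (hA2m2 : ∃ C > 0, ∀ N : ℕ, 2 ≤ N → m2 (w N) / m1 (w N) ≤ C * Real.log N ^ δ)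
    (ν : ℝ) (hν : 0 < ν) :
    ∀ᶠ N : ℕ in atTop,
        (grgMeasure (w N)).real {ω | ∀ x : Fin N, xi ν δ N ≤ (degA (Adj ω) x : ℝ) →
          ∀ p : Fin N, AdjPA (Adj ω) r x p → precA (Adj ω) x p →
            (degPA (Adj ω) r p : ℝ) / 2 ≤ ((SibmA (Adj ω) r x).ncard : ℝ)}ᶜ ≤
          4 * (N : ℝ) ^ (-ν) := by
  obtain ⟨C0, hC0, hm2⟩ := hA2m2
  obtain ⟨m, hm⟩ := exists_nat_ge (2 * (ν + 1) / ε)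
  rw [div_le_iff₀ hε] at hm
  set C := max C0 1 with hCdef
  have hC : 1 ≤ C := le_max_right _ _
  set c := 3 * (ν + 1) * (2 - 3 * δ) / ((1 - δ) * (1 - 2 * δ)) with hcdef
  have hc : 6 * (ν + 1) ≤ c := by
    have h1 : 0 < (1 - δ) * (1 - 2 * δ) := mul_pos (by linarith) (by linarith)
    rw [hcdef, le_div_iff₀ h1]
    have : 0 ≤ 3 * (ν + 1) * (δ * (3 - 4 * δ)) :=
      mul_nonneg (by linarith) (mul_nonneg hδ.le (by linarith))
    nlinarith
  have hlogT : Tendsto (fun N : ℕ => log (N : ℝ)) atTop atTop :=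
    tendsto_log_atTop.comp tendsto_natCast_atTop_atTop
  have hev := hlogT.eventually (eventual (1 / 3 - δ) C ν ε c
    (((2 * r + 1 : ℕ) : ℝ) * ((1 + m * (2 * r + 1) : ℕ) : ℝ)) m (2 * r + 1)
    (by linarith) (by linarith) hC hν hε hc (by linarith) ((m * (2 * r + 1) : ℕ) : ℝ) (by positivity))
  filter_upwards [hev, eventually_ge_atTop 4] with N hN hN4
  have hN0 : (0 : ℝ) < N := by
    have : 0 < N := by omega
    exact_mod_cast this
  set L := log (N : ℝ) with hL
  have hNexp : exp L = N := exp_log hN0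
  have hNr : ∀ x : ℝ, (N : ℝ) ^ x = exp (x * L) := fun x => by
    rw [rpow_def_of_pos hN0, mul_comm]
  obtain ⟨h3, hlog, k1, k2, k3, k4, k5, k6⟩ := hN
  have hs : 1 / 3 - (1 / 3 - δ) = δ := by ring
  rw [hs] at k1 k4 k5
  have hL0 : 0 < L := by linarith
  have hw := hpos N
  set W := ∑ z, w N z with hW
  have hWge : exp ((1 - ε) * L) ≤ W := by
    have h := hA2m1 N (by omega)
    rw [m1, le_div_iff₀ hN0, hNr] at h
    refine le_trans (le_of_eq ?_) h
    rw [show (1 - ε) * L = -ε * L + L by ring, exp_add, hNexp]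
  have hW0 : 0 < W := (exp_pos _).trans_le hWge
  set b : ℝ := exp ((1 / 2 - ε) * L) with hb
  have hbw : ∀ x, w N x ≤ b := fun x => by
    have := hA1 N x; rwa [hNr] at this
  set κ := C * L ^ δ with hκdef
  have hLδ : 1 ≤ L ^ δ := one_le_rpow (by linarith) hδ.le
  have hκ1 : 1 ≤ κ := by nlinarith
  have hκ : ∑ x, w N x ^ 2 ≤ κ * W := by
    have h := hm2 N (by omega)
    rw [m1, m2, div_div_div_cancel_right₀ hN0.ne', div_le_iff₀ hW0] at h
    refine h.trans (mul_le_mul_of_nonneg_right ?_ hW0.le)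
    exact mul_le_mul_of_nonneg_right (le_max_left _ _) (by linarith)
  have hb2 : b ^ 2 ≤ exp (-ε * L) * W := by
    have : b ^ 2 = exp (-ε * L) * exp ((1 - ε) * L) := by
      rw [hb, ← exp_nat_mul, ← exp_add]; congr 1; push_cast; ring
    rw [this]
    exact mul_le_mul_of_nonneg_left hWge (exp_pos _).le
  have hb20 : b ^ 2 / W ≤ exp (-ε * L) := by rwa [div_le_iff₀ hW0]
  have hbW : exp (L / 2) * b ≤ W := by
    refine le_trans (le_of_eq ?_) hWge
    rw [hb, ← exp_add]; congr 1; ring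
  have hb0 : 0 < b := exp_pos _
  have h2 : 2 ≤ exp (L / 2) := by
    have := add_one_le_exp (L / 2); linarith
  have key := finite_bound hw b κ (L ^ (5 / 6 - (1 / 3 - δ) / 2))
    ((1 / 6 + (1 / 3 - δ) / 4) * log L) (xi ν δ N) (L ^ (-(1 / 6 + (1 / 3 - δ)))) (1 / (2 * b)) m r
    hbw hκ1 hκ (rpow_pos_of_pos hL0 _) (by positivity) (by rw [one_div_mul_cancel]; positivity)
    (mul_nonneg (by linarith) hlog.le)
    (by
      intro x y
      have h1 : w N x * w N y ≤ b * b := mul_le_mul (hbw x) (hbw y) (hw y).le hb0.le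
      have h4 : exp (-ε * L) ≤ 1 := by
        rw [exp_le_one_iff]; nlinarith
      have h5 := mul_le_mul_of_nonneg_right h4 hW0.le
      nlinarith)
    (by
      intro p
      have := hbw p
      nlinarith)
    k1 k2
  refine key.trans ?_
  have hxi : xi ν δ N = c * (L / log L) := rfl
  rw [hxi, ← hW, hNr]
  have j2 := k4 (1 / (2 * b) * W) (by
    rw [one_div_mul_eq_div, le_div_iff₀ (by positivity)]; linarith)
  have j3 := k5 (b ^ 2 / W) (by positivity) hb20
  rw [hNexp] at k3 j3 k6
  have e2 : (1 / (2 * b)) * ((2 * (κ * (κ / L ^ (5 / 6 - (1 / 3 - δ) / 2))) -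
      L ^ (-(1 / 6 + (1 / 3 - δ)))) * W) = 1 / (2 * b) * W * (2 * (κ * (κ / L ^ (5 / 6 - (1 / 3 - δ) / 2))) -
      L ^ (-(1 / 6 + (1 / 3 - δ)))) := by ring
  have e3 : ((2 * r + 1 : ℕ) : ℝ) * κ ^ (2 * r + 1) * ((1 + m * (2 * r + 1) : ℕ) : ℝ) * (b ^ 2 / W) =
    ((2 * r + 1 : ℕ) : ℝ) * ((1 + m * (2 * r + 1) : ℕ) : ℝ) * κ ^ (2 * r + 1) * (b ^ 2 / W) := by ring
  rw [e2, e3]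
  linarith

end
end GRGP

open GRG in
/-- High-degree vertices have many smaller siblings.
Under (A1) and (A2), for every `ν > 0`, with `ν`-high probability, for every
`x ∈ V_ν^{(h)}` having a parent `x̂` in `G^p`: `#Sib^−(x) ≥ D_{x̂}^p / 2`. -/
theorem many_smaller_siblings
    (ε δ : ℝ) (hε : 0 < ε) (hε' : ε < 1 / 2) (hδ : 0 < δ) (hδ' : δ < 1 / 3)
    (r : ℕ) (hr : 6 ≤ r)
    (w : (N : ℕ) → Fin N → ℝ)
    (hpos : ∀ N x, 0 < w N x)
    (hA1 : ∀ N x, w N x ≤ (N : ℝ) ^ ((1 : ℝ) / 2 - ε))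
    (hA2m1 : ∀ N : ℕ, 1 ≤ N → (N : ℝ) ^ (-ε) ≤ m1 (w N))
    (hA2m2 : ∃ C > 0, ∀ N : ℕ, 2 ≤ N → m2 (w N) / m1 (w N) ≤ C * Real.log N ^ δ)
    (ν : ℝ) (hν : 0 < ν) :
    ∃ C > (0 : ℝ), ∀ N : ℕ,
      1 - ENNReal.ofReal (C * (N : ℝ) ^ (-ν)) ≤
        grgMeasure (w N) {ω | ∀ x : Fin N, x ∈ VhA (Adj ω) ν δ →
          ∀ p : Fin N, AdjPA (Adj ω) r x p → precA (Adj ω) x p →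
            (degPA (Adj ω) r p : ℝ) / 2 ≤ ((SibmA (Adj ω) r x).ncard : ℝ)} := by
  have hev := GRGP.large_N ε δ hε hε' hδ hδ' r w hpos hA1 hA2m1 hA2m2 ν hν
  obtain ⟨N0, hN0⟩ := Filter.eventually_atTop.1 hev
  refine ⟨4 + (N0 : ℝ) ^ ν, by positivity, ?_⟩
  intro N
  have hpr := GRGP.grg_prob (hpos N)
  rcases Nat.eq_zero_or_pos N with rfl | hNpos
  · have : {ω : EdgeIdx 0 → Bool | ∀ x : Fin 0, x ∈ VhA (Adj ω) ν δ →
          ∀ p : Fin 0, AdjPA (Adj ω) r x p → precA (Adj ω) x p →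
            (degPA (Adj ω) r p : ℝ) / 2 ≤ ((SibmA (Adj ω) r x).ncard : ℝ)} = Set.univ := by
      ext ω
      simp only [Set.mem_univ, iff_true]
      exact fun x => x.elim0
    rw [this, measure_univ]
    exact tsub_le_self
  have hNr : (0 : ℝ) < N := by exact_mod_cast hNpos
  rcases lt_or_ge N N0 with hlt | hge
  · have h1 : (1 : ℝ) ≤ (4 + (N0 : ℝ) ^ ν) * (N : ℝ) ^ (-ν) := by
      have h2 : (N : ℝ) ^ ν ≤ (N0 : ℝ) ^ ν :=
        Real.rpow_le_rpow hNr.le (by exact_mod_cast hlt.le) hν.le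
      rw [Real.rpow_neg hNr.le, ← div_eq_mul_inv, le_div_iff₀ (by positivity)]
      linarith
    rw [tsub_eq_zero_of_le]
    · exact zero_le
    · rw [← ENNReal.ofReal_one]
      exact ENNReal.ofReal_le_ofReal h1
  · have h := hN0 N hge
    set S : Set (EdgeIdx N → Bool) := {ω | ∀ x : Fin N, x ∈ VhA (Adj ω) ν δ →
          ∀ p : Fin N, AdjPA (Adj ω) r x p → precA (Adj ω) x p →
            (degPA (Adj ω) r p : ℝ) / 2 ≤ ((SibmA (Adj ω) r x).ncard : ℝ)} with hS
    change (grgMeasure (w N)).real Sᶜ ≤ _ at h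
    have hb : grgMeasure (w N) Sᶜ ≤ ENNReal.ofReal ((4 + (N0 : ℝ) ^ ν) * (N : ℝ) ^ (-ν)) := by
      rw [← ofReal_measureReal]
      apply ENNReal.ofReal_le_ofReal
      refine h.trans (mul_le_mul_of_nonneg_right ?_ (by positivity))
      have : 0 ≤ (N0 : ℝ) ^ ν := by positivity
      linarith
    rw [tsub_le_iff_right]
    calc (1 : ENNReal) = grgMeasure (w N) (S ∪ Sᶜ) := by rw [Set.union_compl_self, measure_univ]
      _ ≤ grgMeasure (w N) S + grgMeasure (w N) Sᶜ := measure_union_le _ _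
      _ ≤ _ := by gcongr
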